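/- arXiv:2512.00415 — 6 statements merged into one kernel-verified Lean document; each statement's English description precedes it below -/
import Mathlib

section
/- The product of any two regular isodyne topological spaces, each of cardinality ω₁, is ω-resolvable, i.e. it admits countably many pairwise disjoint dense subsets. -/
open Cardinal Topology

/-- A space is `κ`-resolvable iff there are `κ`-many pairwise disjoint dense subsets. -/
def IsResolvable (κ : Cardinal) (X : Type*) [TopologicalSpace X] : Prop :=
  ∃ D : Set (Set X), #D = κ ∧ D.PairwiseDisjoint id ∧ ∀ A ∈ D, Dense A

/-- A space is isodyne iff every nonempty open subset has the cardinality of the whole space. -/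
def Isodyne (X : Type*) [TopologicalSpace X] : Prop :=
  ∀ U : Set X, IsOpen U → U.Nonempty → #U = #X

universe u

/-- A ladder system on a well-order: every `β` carries a cofinal set of elements below it,
containing `⊥`, whose proper initial segments are finite. -/
structure LadderSystem (W : Type u) [LinearOrder W] [OrderBot W] where
  ladder : W → Set W
  lt_of_mem : ∀ {β ξ : W}, ξ ∈ ladder β → ξ < β
  finite_lt : ∀ {α β : W}, α < β → {ξ ∈ ladder β | ξ < α}.Finite
  exists_ge : ∀ {α β : W}, α < β → ∃ ξ ∈ ladder β, α ≤ ξ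
  bot_mem : ∀ {β : W}, ⊥ < β → ⊥ ∈ ladder β

namespace LadderSystem

variable {W : Type u} [LinearOrder W] [OrderBot W]

theorem nonempty_of_countable_Iio (hc : ∀ a : W, (Set.Iio a).Countable) :
    Nonempty (LadderSystem W) := by
  have hf : ∀ β : W, ∃ f : W → ℕ, Set.InjOn f (Set.Iio β) := fun β =>
    Set.countable_iff_exists_injOn.1 (hc β)
  choose f hf using hf
  refine ⟨{
    ladder := fun β => {ξ | ξ < β ∧ ((∀ η < β, f β η < f β ξ → η < ξ) ∨ ξ = ⊥)}
    lt_of_mem := fun h => h.1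
    finite_lt := ?_
    exists_ge := ?_
    bot_mem := fun h => ⟨h, Or.inr rfl⟩ }⟩
  · intro α β hαβ
    have h1 : (insert ⊥ {ξ | ξ < β ∧ f β ξ ≤ f β α}).Finite := by
      refine Set.Finite.insert _ ?_
      refine Set.Finite.of_finite_image (f := f β) ?_ ((hf β).mono fun x hx => hx.1)
      refine (Set.finite_Iic (f β α)).subset ?_
      rintro _ ⟨x, hx, rfl⟩
      exact hx.2
    refine h1.subset ?_
    rintro ξ ⟨⟨hξ, h | h⟩, hlt⟩
    · right
      refine ⟨hξ, not_lt.1 fun h' => ?_⟩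
      exact (h α hαβ h').not_gt hlt
    · exact Or.inl h
  · intro α β hαβ
    obtain ⟨ξ, ⟨hξα, hξβ⟩, hmin⟩ :=
      (measure (f β)).wf.has_min {ξ | α ≤ ξ ∧ ξ < β} ⟨α, le_rfl, hαβ⟩
    refine ⟨ξ, ⟨hξβ, Or.inl fun η hη hlt => ?_⟩, hξα⟩
    by_contra hge
    exact hmin η ⟨hξα.trans (not_lt.1 hge), hη⟩ hlt

variable (C : LadderSystem W)

theorem finite_ladder_ncard_le (β : W) (n : ℕ) :
    {c ∈ C.ladder β | {ξ ∈ C.ladder β | ξ < c}.ncard ≤ n}.Finite := by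
  refine Set.Finite.of_finite_image (f := fun c => {ξ ∈ C.ladder β | ξ < c}.ncard)
    ((Set.finite_Iic n).subset ?_) ?_
  · rintro _ ⟨c, hc, rfl⟩
    exact hc.2
  · have hmono : ∀ c d, c ∈ C.ladder β → d ∈ C.ladder β → c < d →
        {ξ ∈ C.ladder β | ξ < c}.ncard < {ξ ∈ C.ladder β | ξ < d}.ncard := by
      intro c d hc hd hcd
      refine Set.ncard_lt_ncard ⟨fun ξ hξ => ⟨hξ.1, hξ.2.trans hcd⟩, fun hsub => ?_⟩
        (C.finite_lt (C.lt_of_mem hd))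
      exact lt_irrefl c (hsub ⟨hc, hcd⟩).2
    intro c hc d hd hcd
    rcases lt_trichotomy c d with h | h | h
    · exact absurd hcd (hmono c d hc.1 hd.1 h).ne
    · exact h
    · exact absurd hcd (hmono d c hd.1 hc.1 h).ne'

variable [WellFoundedLT W]

/-- The first step of the minimal walk from `β` to `α`: the least element of the ladder of `β`
which is at least `α` (and `α` if there is none). -/
noncomputable def next (α β : W) : W :=
  open Classical in
  if h : {ξ | ξ ∈ C.ladder β ∧ α ≤ ξ}.Nonempty then wellFounded_lt.min _ h else α

variable {α β γ δ ξ : W}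

theorem next_mem_and_le (h : α < β) : C.next α β ∈ C.ladder β ∧ α ≤ C.next α β := by
  have hne : {ξ | ξ ∈ C.ladder β ∧ α ≤ ξ}.Nonempty := C.exists_ge h
  rw [next, dif_pos hne]
  exact wellFounded_lt.min_mem _ hne

theorem next_mem (h : α < β) : C.next α β ∈ C.ladder β := (C.next_mem_and_le h).1

theorem le_next (h : α < β) : α ≤ C.next α β := (C.next_mem_and_le h).2

theorem next_lt (h : α < β) : C.next α β < β := C.lt_of_mem (C.next_mem h)

theorem next_le (hξ : ξ ∈ C.ladder β) (h : α ≤ ξ) : C.next α β ≤ ξ := by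
  have hne : {ξ | ξ ∈ C.ladder β ∧ α ≤ ξ}.Nonempty := ⟨ξ, hξ, h⟩
  rw [next, dif_pos hne]
  exact not_lt.1 (wellFounded_lt.not_lt_min _ (show ξ ∈ {ξ | ξ ∈ C.ladder β ∧ α ≤ ξ} from ⟨hξ, h⟩))

theorem next_eq_next (hαβ : α ≤ β) (hβγ : β < γ) (h : ∀ ξ ∈ C.ladder γ, ξ < β → ξ < α) :
    C.next α γ = C.next β γ := by
  have hαγ := hαβ.trans_lt hβγ
  refine le_antisymm (C.next_le (C.next_mem hβγ) (hαβ.trans (C.le_next hβγ))) ?_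
  refine C.next_le (C.next_mem hαγ) (not_lt.1 fun hlt => ?_)
  exact (h _ (C.next_mem hαγ) hlt).not_ge (C.le_next hαγ)

/-- The maximal weight `ρ₁` of the walk from `β` to `α`. -/
noncomputable def weight (α β : W) : ℕ :=
  open Classical in
  if _h : α < β then max {ξ ∈ C.ladder β | ξ < α}.ncard (weight α (C.next α β)) else 0
termination_by wellFounded_lt.wrap β
decreasing_by exact C.next_lt _h

theorem weight_of_lt (h : α < β) :
    C.weight α β = max {ξ ∈ C.ladder β | ξ < α}.ncard (C.weight α (C.next α β)) := by
  rw [weight, dif_pos h]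

/-- The lower trace of the walk from `β` to `α`. -/
noncomputable def trace (α β : W) : Set W :=
  open Classical in
  if _h : α < β then
    {x | (x ∈ C.ladder β ∧ x < α ∨ x ∈ trace α (C.next α β)) ∧
      ∀ ξ ∈ C.ladder β, ξ < α → ξ ≤ x}
  else ∅
termination_by wellFounded_lt.wrap β
decreasing_by exact C.next_lt _h

theorem mem_trace_of_lt (h : α < β) {x : W} :
    x ∈ C.trace α β ↔ (x ∈ C.ladder β ∧ x < α ∨ x ∈ C.trace α (C.next α β)) ∧
      ∀ ξ ∈ C.ladder β, ξ < α → ξ ≤ x := by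
  rw [trace, dif_pos h]
  rfl

theorem trace_of_le (h : β ≤ α) : C.trace α β = ∅ := by
  rw [trace, dif_neg h.not_gt]

theorem finite_trace (α β : W) : (C.trace α β).Finite := by
  induction β using WellFoundedLT.induction with
  | ind β ih =>
    rcases le_or_gt β α with h | h
    · rw [C.trace_of_le h]
      exact Set.finite_empty
    · refine ((C.finite_lt h).union (ih _ (C.next_lt h))).subset fun x hx => ?_
      exact ((C.mem_trace_of_lt h).1 hx).1

theorem lt_of_mem_trace {x : W} (hx : x ∈ C.trace α β) : x < α := by
  induction β using WellFoundedLT.induction with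
  | ind β ih =>
    rcases le_or_gt β α with h | h
    · simp [C.trace_of_le h] at hx
    · rcases ((C.mem_trace_of_lt h).1 hx).1 with h' | h'
      · exact h'.2
      · exact ih _ (C.next_lt h) h'

theorem le_of_mem_trace {x : W} (hx : x ∈ C.trace α β) (hξ : ξ ∈ C.ladder β) (h : ξ < α) :
    ξ ≤ x := by
  rcases le_or_gt β α with hle | hlt
  · simp [C.trace_of_le hle] at hx
  · exact ((C.mem_trace_of_lt hlt).1 hx).2 ξ hξ h

theorem exists_max_ladder_mem_trace (h0 : ⊥ < α) (h : α < β) :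
    ∃ m ∈ C.trace α β, m ∈ C.ladder β := by
  obtain ⟨m, hm, hmax⟩ := Set.exists_max_image _ id (C.finite_lt h)
    ⟨⊥, C.bot_mem (h0.trans h), h0⟩
  exact ⟨m, (C.mem_trace_of_lt h).2 ⟨Or.inl hm, fun ξ hξ hlt => hmax ξ ⟨hξ, hlt⟩⟩, hm.1⟩

theorem trace_nonempty (h0 : ⊥ < α) (h : α < β) : (C.trace α β).Nonempty :=
  let ⟨m, hm, _⟩ := C.exists_max_ladder_mem_trace h0 h
  ⟨m, hm⟩

/-- Lower traces concatenate when the later one lies entirely below the earlier one. -/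
theorem trace_eq_union (h0 : ⊥ < α) (hαβ : α < β) (hβγ : β ≤ γ)
    (hlt : ∀ x ∈ C.trace β γ, ∀ y ∈ C.trace α β, x < y) :
    C.trace α γ = C.trace β γ ∪ C.trace α β := by
  induction γ using WellFoundedLT.induction with
  | ind γ ih =>
    rcases hβγ.eq_or_lt with rfl | hβγ
    · simp [C.trace_of_le le_rfl]
    · have hαγ := hαβ.trans hβγ
      obtain ⟨y, hy⟩ := C.trace_nonempty h0 hαβ
      obtain ⟨m, hm, hmC⟩ := C.exists_max_ladder_mem_trace (h0.trans hαβ) hβγ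
      have hmα : m < α := (hlt m hm y hy).trans (C.lt_of_mem_trace hy)
      have hladder : ∀ ξ ∈ C.ladder γ, ξ < β → ξ < α := fun ξ hξ hξβ =>
        (C.le_of_mem_trace hm hξ hξβ).trans_lt hmα
      have hnext := C.next_eq_next hαβ.le hβγ hladder
      have hle : ∀ y ∈ C.trace α β, ∀ ξ ∈ C.ladder γ, ξ < α → ξ ≤ y := fun y hy ξ hξ hξα =>
        (C.le_of_mem_trace hm hξ (hξα.trans hαβ)).trans (hlt m hm y hy).le
      have key : C.trace α (C.next β γ) = C.trace β (C.next β γ) ∪ C.trace α β := by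
        refine ih _ (C.next_lt hβγ) (C.le_next hβγ) fun x hx y hy => ?_
        rcases le_or_gt m x with hmx | hmx
        · refine hlt x ((C.mem_trace_of_lt hβγ).2 ⟨Or.inr hx, fun ξ hξ hξβ => ?_⟩) y hy
          exact (C.le_of_mem_trace hm hξ hξβ).trans hmx
        · exact hmx.trans (hlt m hm y hy)
      ext x
      rw [Set.mem_union, C.mem_trace_of_lt hαγ, C.mem_trace_of_lt hβγ, hnext, key, Set.mem_union]
      constructor
      · rintro ⟨(⟨h1, h2⟩ | h1 | h1), h3⟩
        · exact Or.inl ⟨Or.inl ⟨h1, h2.trans hαβ⟩, fun ξ hξ h => h3 ξ hξ (hladder ξ hξ h)⟩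
        · exact Or.inl ⟨Or.inr h1, fun ξ hξ h => h3 ξ hξ (hladder ξ hξ h)⟩
        · exact Or.inr h1
      · rintro (⟨(⟨h1, h2⟩ | h1), h3⟩ | h1)
        · exact ⟨Or.inl ⟨h1, hladder x h1 h2⟩, fun ξ hξ h => h3 ξ hξ (h.trans hαβ)⟩
        · exact ⟨Or.inr (Or.inl h1), fun ξ hξ h => h3 ξ hξ (h.trans hαβ)⟩
        · exact ⟨Or.inr (Or.inr h1), hle x h1⟩

/-- The function `α ↦ ρ₁(α, β)` is finite-to-one. -/
theorem finite_weight_le (β : W) (n : ℕ) : {α | α < β ∧ C.weight α β ≤ n}.Finite := by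
  induction β using WellFoundedLT.induction with
  | ind β ih =>
    have hfin : (⋃ c ∈ {c ∈ C.ladder β | {ξ ∈ C.ladder β | ξ < c}.ncard ≤ n},
        insert c {α | α < c ∧ C.weight α c ≤ n}).Finite :=
      (C.finite_ladder_ncard_le β n).biUnion fun c hc => (ih c (C.lt_of_mem hc.1)).insert c
    refine hfin.subset ?_
    rintro α ⟨hαβ, hα⟩
    rw [C.weight_of_lt hαβ, max_le_iff] at hα
    refine Set.mem_biUnion (x := C.next α β) ⟨C.next_mem hαβ, le_trans (le_of_eq ?_) hα.1⟩ ?_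
    · congr 1
      ext ξ
      refine and_congr_right fun hξ => ⟨fun h => not_le.1 fun h' => ?_,
        fun h => h.trans_le (C.le_next hαβ)⟩
      exact (C.next_le hξ h').not_gt h
    · rcases (C.le_next hαβ).eq_or_lt with h | h
      · exact Or.inl h
      · exact Or.inr ⟨h, hα.2⟩

/-- The functions `ρ₁(·, α)` and `ρ₁(·, β)` agree below `α ≤ β` up to finitely many values. -/
theorem finite_weight_ne (h : α ≤ β) : {ξ | ξ < α ∧ C.weight ξ α ≠ C.weight ξ β}.Finite := by
  induction β using WellFoundedLT.induction generalizing α with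
  | ind β ih =>
    rcases h.eq_or_lt with rfl | hαβ
    · simp
    set S := {ξ ∈ C.ladder β | ξ < α} with hS
    have hSfin : S.Finite := C.finite_lt hαβ
    have hcoh : ∀ c < β, {ξ | ξ < α ∧ ξ < c ∧ C.weight ξ c ≠ C.weight ξ α}.Finite := by
      intro c hc
      rcases le_total c α with hcα | hcα
      · exact (ih α hαβ hcα).subset fun ξ hξ => ⟨hξ.2.1, hξ.2.2⟩
      · exact (ih c hc hcα).subset fun ξ hξ => ⟨hξ.1, hξ.2.2.symm⟩
    have hT : (insert (C.next α β) S).Finite := hSfin.insert _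
    have hTβ : ∀ c ∈ insert (C.next α β) S, c < β := by
      rintro c (rfl | hc)
      · exact C.next_lt hαβ
      · exact C.lt_of_mem hc.1
    have hfin : (⋃ c ∈ insert (C.next α β) S, insert c
        ({ξ | ξ < α ∧ ξ < c ∧ C.weight ξ c ≠ C.weight ξ α} ∪
          {ξ | ξ < c ∧ C.weight ξ c ≤ S.ncard})).Finite :=
      hT.biUnion fun c hc => ((hcoh c (hTβ c hc)).union (C.finite_weight_le c _)).insert c
    refine hfin.subset ?_
    rintro ξ ⟨hξα, hne⟩
    have hξβ := hξα.trans hαβ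
    have hmem : C.next ξ β ∈ insert (C.next α β) S := by
      rcases lt_or_ge (C.next ξ β) α with h' | h'
      · exact Or.inr ⟨C.next_mem hξβ, h'⟩
      · refine Or.inl (C.next_eq_next hξα.le hαβ fun η hη hηα => not_le.1 fun hle => ?_)
        exact (h'.trans (C.next_le hη hle)).not_gt hηα
    refine Set.mem_biUnion hmem ?_
    rcases (C.le_next hξβ).eq_or_lt with h' | h'
    · exact Or.inl h'
    right
    by_cases hle : C.weight ξ (C.next ξ β) ≤ S.ncard
    · exact Or.inr ⟨h', hle⟩
    · refine Or.inl ⟨hξα, h', fun heq => hne ?_⟩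
      rw [C.weight_of_lt hξβ, ← heq, eq_comm, max_eq_right]
      refine le_trans (Set.ncard_le_ncard (t := S) (fun η hη => ⟨hη.1, hη.2.trans hξα⟩) hSfin) ?_
      exact (not_le.1 hle).le

/-- The elements of `F` lying in `P` whose immediate predecessor in `F` exists and is not in `P`. -/
def oscillation (P F : Set W) : Set W :=
  {ξ | ξ ∈ F ∧ ξ ∈ P ∧ ∃ η ∈ F, η < ξ ∧ η ∉ P ∧ ∀ ζ ∈ F, ζ ≤ η ∨ ξ ≤ ζ}

section Oscillation

omit [OrderBot W] [WellFoundedLT W]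

variable {P Q F G : Set W}

theorem oscillation_congr (h : ∀ ξ ∈ F, ξ ∈ P ↔ ξ ∈ Q) : oscillation P F = oscillation Q F := by
  ext ξ
  refine and_congr_right fun hξ => and_congr (h ξ hξ) (exists_congr fun η => ?_)
  refine and_congr_right fun hη => and_congr_right fun _ => and_congr_left fun _ => ?_
  exact not_congr (h η hη)

theorem oscillation_union (hFG : ∀ x ∈ F, ∀ y ∈ G, x < y)
    (hmax : ∃ μ ∈ F, μ ∈ P ∧ ∀ ζ ∈ F, ζ ≤ μ) :
    oscillation P (F ∪ G) = oscillation P F ∪ oscillation P G := by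
  obtain ⟨μ, hμF, hμP, hμ⟩ := hmax
  ext ξ
  constructor
  · rintro ⟨hξ | hξ, hξP, η, hη | hη, hlt, hηP, hpred⟩
    · exact Or.inl ⟨hξ, hξP, η, hη, hlt, hηP, fun ζ hζ => hpred ζ (Or.inl hζ)⟩
    · exact absurd hlt (hFG ξ hξ η hη).not_gt
    · exfalso
      rcases hpred μ (Or.inl hμF) with h | h
      · exact hηP (le_antisymm h (hμ η hη) ▸ hμP)
      · exact (hFG μ hμF ξ hξ).not_ge h
    · exact Or.inr ⟨hξ, hξP, η, hη, hlt, hηP, fun ζ hζ => hpred ζ (Or.inr hζ)⟩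
  · rintro (⟨hξ, hξP, η, hη, hlt, hηP, hpred⟩ | ⟨hξ, hξP, η, hη, hlt, hηP, hpred⟩)
    · refine ⟨Or.inl hξ, hξP, η, Or.inl hη, hlt, hηP, ?_⟩
      rintro ζ (hζ | hζ)
      · exact hpred ζ hζ
      · exact Or.inr (hFG ξ hξ ζ hζ).le
    · refine ⟨Or.inr hξ, hξP, η, Or.inr hη, hlt, hηP, ?_⟩
      rintro ζ (hζ | hζ)
      · exact Or.inl (hFG ζ hζ η hη).le
      · exact hpred ζ hζ

theorem ncard_oscillation_union (hF : F.Finite) (hG : G.Finite) (hFG : ∀ x ∈ F, ∀ y ∈ G, x < y)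
    (hmax : ∃ μ ∈ F, μ ∈ P ∧ ∀ ζ ∈ F, ζ ≤ μ) :
    (oscillation P (F ∪ G)).ncard = (oscillation P F).ncard + (oscillation P G).ncard := by
  rw [oscillation_union hFG hmax, Set.ncard_union_eq _ (hF.subset fun x hx => hx.1)
    (hG.subset fun x hx => hx.1)]
  exact Set.disjoint_left.2 fun x hx hy => lt_irrefl x (hFG x hx.1 x hy.1)

theorem ncard_oscillation_eq_one (hF : F.Finite) (hG : G.Finite) (hF0 : F.Nonempty)
    (hG0 : G.Nonempty) (hFG : ∀ x ∈ F, ∀ y ∈ G, x < y) (hFP : ∀ x ∈ F, x ∉ P)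
    (hGP : ∀ x ∈ G, x ∈ P) : (oscillation P (F ∪ G)).ncard = 1 := by
  obtain ⟨μ, hμ, hμmax⟩ := Set.exists_max_image F id hF hF0
  obtain ⟨ν, hν, hνmin⟩ := Set.exists_min_image G id hG hG0
  rw [Set.ncard_eq_one]
  refine ⟨ν, Set.eq_singleton_iff_unique_mem.2 ⟨?_, ?_⟩⟩
  · refine ⟨Or.inr hν, hGP ν hν, μ, Or.inl hμ, hFG μ hμ ν hν, hFP μ hμ, ?_⟩
    rintro ζ (hζ | hζ)
    · exact Or.inl (hμmax ζ hζ)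
    · exact Or.inr (hνmin ζ hζ)
  · rintro ξ ⟨hξ | hξ, hξP, η, hη | hη, hlt, hηP, hpred⟩
    · exact absurd hξP (hFP ξ hξ)
    · exact absurd hξP (hFP ξ hξ)
    · rcases hpred ν (Or.inr hν) with h | h
      · exact absurd h (hFG η hη ν hν).not_ge
      · exact le_antisymm h (hνmin ξ hξ)
    · exact absurd (hGP η hη) hηP

end Oscillation

section Uncountable

variable [Uncountable W]

omit [OrderBot W] [WellFoundedLT W] in
theorem exists_gt_of_countable (hc : ∀ a : W, (Set.Iio a).Countable) {S : Set W}
    (hS : S.Countable) : ∃ x, ∀ s ∈ S, s < x := by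
  by_contra! h
  have : (⋃ s ∈ S, insert s (Set.Iio s)).Countable := hS.biUnion fun s _ => (hc s).insert s
  refine Set.not_countable_univ (this.mono fun x _ => ?_)
  obtain ⟨s, hs, hxs⟩ := h x
  refine Set.mem_biUnion hs ?_
  rcases hxs.eq_or_lt with h' | h'
  · exact Or.inl h'
  · exact Or.inr h'

omit [OrderBot W] [WellFoundedLT W] [Uncountable W] in
theorem exists_gt_of_not_countable (hc : ∀ a : W, (Set.Iio a).Countable) {S : Set W}
    (hS : ¬ S.Countable) (a : W) : ∃ x ∈ S, a < x := by
  by_contra! h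
  refine hS (((hc a).insert a).mono fun x hx => ?_)
  rcases (h x hx).eq_or_lt with h' | h'
  · exact Or.inl h'
  · exact Or.inr h'

omit [WellFoundedLT W] [OrderBot W] [Uncountable W] in
theorem countable_setOf_support_lt (hc : ∀ a : W, (Set.Iio a).Countable) (y : W) :
    {p : Finset (W × ℕ × ℕ) × W | (∀ x ∈ p.1, x.1 < y) ∧ p.2 < y}.Countable := by
  have h1 : {x : W × ℕ × ℕ | x.1 < y}.Countable := by
    refine Set.Countable.mono ?_ ((hc y).prod (Set.countable_univ (α := ℕ × ℕ)))
    exact fun x hx => ⟨hx, trivial⟩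
  have h2 : {s : Finset (W × ℕ × ℕ) | ∀ x ∈ s, x.1 < y}.Countable := by
    refine Set.Countable.mono ?_ ((Set.countable_ofPred_finite_subset h1).preimage_of_injOn
      Finset.coe_injective.injOn)
    exact fun s hs => ⟨s.finite_toSet, hs⟩
  exact (h2.prod (hc y)).mono fun p hp => hp

/-- Closing-off: there is a limit point closed under countably-valued operations on finite data. -/
theorem exists_closed (hc : ∀ a : W, (Set.Iio a).Countable)
    (K : Finset (W × ℕ × ℕ) × W → Set W) (hK : ∀ p, (K p).Countable) :
    ∃ δ : W, ⊥ < δ ∧ (∀ ξ < δ, ∃ η < δ, ξ < η) ∧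
      ∀ p : Finset (W × ℕ × ℕ) × W, (∀ x ∈ p.1, x.1 < δ) → p.2 < δ → ∀ y ∈ K p, y < δ := by
  have h1 : ∀ y : W, ∃ z, y < z ∧ ∀ p : Finset (W × ℕ × ℕ) × W,
      (∀ x ∈ p.1, x.1 < y) → p.2 < y → ∀ x ∈ K p, x < z := by
    intro y
    obtain ⟨z, hz⟩ := exists_gt_of_countable hc
      (((countable_setOf_support_lt hc y).biUnion fun p _ => hK p).insert y)
    exact ⟨z, hz y (Or.inl rfl), fun p hp hp' x hx => hz x (Or.inr (Set.mem_biUnion ⟨hp, hp'⟩ hx))⟩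
  choose f hf hfK using h1
  let s : ℕ → W := fun n => f^[n] ⊥
  have hs : ∀ n, s (n + 1) = f (s n) := fun n => Function.iterate_succ_apply' f n ⊥
  have hlt : ∀ n, s n < s (n + 1) := fun n => by rw [hs]; exact hf _
  have hmono : StrictMono s := strictMono_nat_of_lt_succ hlt
  obtain ⟨b, hb⟩ := exists_gt_of_countable hc (Set.countable_range s)
  obtain ⟨δ, hδ, hmin⟩ := wellFounded_lt.has_min {y | ∀ n, s n < y}
    ⟨b, fun n => hb _ (Set.mem_range_self n)⟩
  have hbelow : ∀ ξ < δ, ∃ n, ξ < s n := by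
    intro ξ hξ
    by_contra! h
    exact hmin ξ (fun n => (hlt n).trans_le (h (n + 1))) hξ
  refine ⟨δ, hδ 0, fun ξ hξ => ?_, fun p hp hp' y hy => ?_⟩
  · obtain ⟨n, hn⟩ := hbelow ξ hξ
    exact ⟨s n, hδ n, hn⟩
  · choose! n hn using hbelow
    let N := p.1.sup (fun x => n x.1) ⊔ n p.2
    refine lt_trans (b := s (N + 1)) ?_ (hδ _)
    rw [hs]
    refine hfK (s N) p (fun x hx => ?_) ?_ y hy
    · refine (hn x.1 (hp x hx)).trans_le (hmono.monotone ?_)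
      exact (Finset.le_sup (f := fun x : W × ℕ × ℕ => n x.1) hx).trans le_sup_left
    · exact (hn p.2 hp').trans_le (hmono.monotone le_sup_right)

/-- Past some point, arbitrarily large weights are realised on every finite set by members of an
uncountable set. -/
theorem exists_forall_weight_gt (hc : ∀ a : W, (Set.Iio a).Countable) {A : Set W}
    (hA : ¬ A.Countable) :
    ∃ γ : W, ∀ F : Set W, F.Finite → (∀ x ∈ F, γ ≤ x) → ∀ (n : ℕ) (ζ : W),
      ∃ a ∈ A, ζ < a ∧ ∀ ξ ∈ F, n < C.weight ξ a := by
  suffices h : ∀ n : ℕ, ∃ γ : W, ∀ F : Set W, F.Finite → (∀ x ∈ F, γ ≤ x) → ∀ ζ : W,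
      ∃ a ∈ A, ζ < a ∧ ∀ ξ ∈ F, n < C.weight ξ a by
    choose g hg using h
    obtain ⟨γ, hγ⟩ := exists_gt_of_countable hc (Set.countable_range g)
    exact ⟨γ, fun F hF hFγ n ζ =>
      hg n F hF (fun x hx => (hγ _ (Set.mem_range_self n)).le.trans (hFγ x hx)) ζ⟩
  intro n
  by_contra! hbad
  choose F hF hFγ ζ hζ using hbad
  have h1 : ∀ γ, ∃ z, ζ γ < z ∧ ∀ x ∈ F γ, x < z := by
    intro γ
    obtain ⟨z, hz⟩ := exists_gt_of_countable hc ((hF γ).countable.insert (ζ γ))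
    exact ⟨z, hz _ (Or.inl rfl), fun x hx => hz x (Or.inr hx)⟩
  choose u huζ huF using h1
  let s : ℕ → W := fun i => u^[i] ⊥
  have hs : ∀ i, s (i + 1) = u (s i) := fun i => Function.iterate_succ_apply' u i ⊥
  obtain ⟨z, hz⟩ := exists_gt_of_countable hc (Set.countable_range s)
  obtain ⟨a, haA, hza⟩ := exists_gt_of_not_countable hc hA z
  have hsa : ∀ i, s i < a := fun i => (hz _ (Set.mem_range_self i)).trans hza
  have hx : ∀ i, ∃ x ∈ F (s i), C.weight x a ≤ n := fun i =>
    hζ (s i) a haA ((huζ (s i)).trans (hs i ▸ hsa (i + 1)))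
  choose x hxF hxn using hx
  have hxs : ∀ i, x i < s (i + 1) := fun i => by rw [hs]; exact huF _ _ (hxF i)
  have hmono : StrictMono x :=
    strictMono_nat_of_lt_succ fun i => (hxs i).trans_le (hFγ _ _ (hxF (i + 1)))
  exact Set.infinite_of_injective_forall_mem (s := {ξ | ξ < a ∧ C.weight ξ a ≤ n})
    hmono.injective (fun i => ⟨(hxs i).trans (hsa _), hxn i⟩) (C.finite_weight_le a n)

omit [Uncountable W] [WellFoundedLT W] in
theorem exists_ladder_gt (h0 : ⊥ < δ) (hlim : ∀ ξ < δ, ∃ η < δ, ξ < η) {G : Set W}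
    (hG : G.Finite) (hGδ : ∀ x ∈ G, x < δ) : ∃ γ ∈ C.ladder δ, ∀ x ∈ G, x < γ := by
  obtain ⟨m, hm, hmax⟩ := Set.exists_max_image _ id (hG.insert ⊥) ⟨⊥, Or.inl rfl⟩
  have hmδ : m < δ := by
    rcases hm with rfl | hm
    · exact h0
    · exact hGδ m hm
  obtain ⟨η, hη, hmη⟩ := hlim m hmδ
  obtain ⟨γ, hγ, hηγ⟩ := C.exists_ge hη
  exact ⟨γ, hγ, fun x hx => (hmax x (Or.inr hx)).trans_lt (hmη.trans_le hηγ)⟩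

omit [Uncountable W] in
/-- If `γ` is a rung of the ladder of `δ'` lying between the trace from `δ'` to `b` and `δ`, then the
trace from `δ` to `b` end-extends the trace from `δ'` to `b` by elements at or above `γ`. -/
theorem trace_end_extension {δ' b : W} {T : Set W} (h0 : ⊥ < δ) (hγ : γ ∈ C.ladder δ')
    (hγδ : γ < δ) (hδ : δ < δ') (hb : δ' ≤ b) (hT : C.trace δ' b = T) (hTγ : ∀ x ∈ T, x < γ) :
    C.trace δ b = T ∪ C.trace δ δ' ∧ (C.trace δ δ').Nonempty ∧
      (∀ x ∈ C.trace δ δ', γ ≤ x ∧ x < δ) ∧ ∀ x ∈ T, ∀ y ∈ C.trace δ δ', x < y := by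
  have hge : ∀ x ∈ C.trace δ δ', γ ≤ x := fun x hx => C.le_of_mem_trace hx hγ hγδ
  have hsep : ∀ x ∈ T, ∀ y ∈ C.trace δ δ', x < y := fun x hx y hy => (hTγ x hx).trans_le (hge y hy)
  refine ⟨?_, C.trace_nonempty h0 hδ, fun x hx => ⟨hge x hx, C.lt_of_mem_trace hx⟩, hsep⟩
  subst hT
  exact C.trace_eq_union h0 hδ hb hsep

/-- The pair `(a', b')` has the same weights as `(a, b)` on the trace from `δ` to `b`, and the trace
from `δ` to `b'` end-extends it by a nonempty set on which the weights are related by `R`. -/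
def EndExtends (R : ℕ → ℕ → Prop) (δ a b a' b' : W) : Prop :=
  ∃ F : Set W, F.Nonempty ∧ F.Finite ∧ C.trace δ b' = C.trace δ b ∪ F ∧
    (∀ x ∈ C.trace δ b, ∀ y ∈ F, x < y) ∧
    (∀ x ∈ C.trace δ b, C.weight x a' = C.weight x a ∧ C.weight x b' = C.weight x b) ∧
    ∀ x ∈ F, R (C.weight x b') (C.weight x a')

open Classical in
/-- For uncountable `A` and `B` there is a limit `δ` past which traces can be end-extended with
either behaviour of the weights, and below which the members of `A` are reflected. -/
theorem exists_reflecting (hc : ∀ a : W, (Set.Iio a).Countable) (A B : Set W) :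
    ∃ δ : W, ⊥ < δ ∧ (∀ ξ < δ, ∃ η < δ, ξ < η) ∧
      (∀ a ∈ A, ∀ b ∈ B, δ ≤ a → δ ≤ b →
        ∃ a' ∈ A, ∃ b' ∈ B, δ ≤ a' ∧ δ ≤ b' ∧ C.EndExtends (· = ·) δ a b a' b') ∧
      (∀ a ∈ A, ∀ b ∈ B, δ ≤ a → δ ≤ b →
        ∃ a' ∈ A, ∃ b' ∈ B, δ ≤ a' ∧ δ ≤ b' ∧ C.EndExtends (· < ·) δ a b a' b') ∧
      ∀ a ∈ A, ∀ b ∈ B, δ ≤ a → δ ≤ b → ∀ γ < δ,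
        ∃ α ∈ A, γ < α ∧ α < δ ∧ ∀ x ∈ C.trace δ b, C.weight x α = C.weight x a := by
  let MA : Finset (W × ℕ × ℕ) → Set W := fun p => {a ∈ A | ∀ x ∈ p, C.weight x.1 a = x.2.1}
  let SE : Finset (W × ℕ × ℕ) × W → Set W := fun p =>
    {δ | p.2 ∈ C.ladder δ ∧ ∃ a ∈ A, ∃ b ∈ B, δ ≤ a ∧ δ ≤ b ∧
      C.trace δ b = {x | ∃ y ∈ p.1, y.1 = x} ∧
      (∀ x ∈ p.1, C.weight x.1 a = x.2.1 ∧ C.weight x.1 b = x.2.2) ∧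
      ∀ ξ, p.2 ≤ ξ → ξ < δ → C.weight ξ b = C.weight ξ a}
  let SG : Finset (W × ℕ × ℕ) × W → Set W := fun p =>
    {δ | p.2 ∈ C.ladder δ ∧ ∃ b ∈ B, δ ≤ b ∧ C.trace δ b = {x | ∃ y ∈ p.1, y.1 = x} ∧
      ∀ x ∈ p.1, C.weight x.1 b = x.2.2}
  have hg : ∀ p : Finset (W × ℕ × ℕ), ∃ γ : W, ¬ (MA p).Countable → ∀ F : Set W, F.Finite →
      (∀ x ∈ F, γ ≤ x) → ∀ (n : ℕ) (ζ : W), ∃ a ∈ MA p, ζ < a ∧ ∀ ξ ∈ F, n < C.weight ξ a := by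
    intro p
    by_cases h : (MA p).Countable
    · exact ⟨⊥, fun h' => absurd h h'⟩
    · obtain ⟨γ, hγ⟩ := C.exists_forall_weight_gt hc h
      exact ⟨γ, fun _ => hγ⟩
  choose g hg using hg
  have hu : ∀ p : Finset (W × ℕ × ℕ) × W, ∃ α, ¬ (MA p.1).Countable → α ∈ MA p.1 ∧ p.2 < α := by
    intro p
    by_cases h : (MA p.1).Countable
    · exact ⟨⊥, fun h' => absurd h h'⟩
    · obtain ⟨α, hα⟩ := exists_gt_of_not_countable hc h p.2
      exact ⟨α, fun _ => hα⟩
  choose u hu using hu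
  have htrim : ∀ S : Set W, {x ∈ S | S.Countable}.Countable := by
    intro S
    by_cases h : S.Countable
    · exact h.mono fun x hx => hx.1
    · exact Set.Countable.mono (fun x hx => absurd hx.2 h) Set.countable_empty
  obtain ⟨δ, h0, hlim, hclosed⟩ := exists_closed hc
    (fun p => {x ∈ MA p.1 | (MA p.1).Countable} ∪ {x ∈ SE p | (SE p).Countable} ∪
      {x ∈ SG p | (SG p).Countable} ∪ {g p.1, u p})
    (fun p => (((htrim _).union (htrim _)).union (htrim _)).union
      ((Set.countable_singleton _).insert _))
  have hpat : ∀ a b : W, ∃ p : Finset (W × ℕ × ℕ),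
      ∀ y, y ∈ p ↔ ∃ x ∈ C.trace δ b, (x, C.weight x a, C.weight x b) = y := fun a b =>
    ⟨((C.finite_trace δ b).image fun x => (x, C.weight x a, C.weight x b)).toFinset, fun y => by
      rw [Set.Finite.mem_toFinset]; rfl⟩
  choose p hp using hpat
  have hpδ : ∀ a b, ∀ x ∈ p a b, x.1 < δ := by
    intro a b y hy
    obtain ⟨x, hx, rfl⟩ := (hp a b y).1 hy
    exact C.lt_of_mem_trace hx
  have hptrace : ∀ a b, C.trace δ b = {x | ∃ y ∈ p a b, y.1 = x} := by
    intro a b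
    ext x
    constructor
    · exact fun hx => ⟨_, (hp a b _).2 ⟨x, hx, rfl⟩, rfl⟩
    · rintro ⟨y, hy, rfl⟩
      obtain ⟨x, hx, rfl⟩ := (hp a b y).1 hy
      exact hx
  have hpval : ∀ a b, ∀ y ∈ p a b, C.weight y.1 a = y.2.1 ∧ C.weight y.1 b = y.2.2 := by
    intro a b y hy
    obtain ⟨x, hx, rfl⟩ := (hp a b y).1 hy
    exact ⟨rfl, rfl⟩
  have hpmem : ∀ a b, ∀ x ∈ C.trace δ b, (x, C.weight x a, C.weight x b) ∈ p a b :=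
    fun a b x hx => (hp a b _).2 ⟨x, hx, rfl⟩
  have hMA : ∀ a ∈ A, ∀ b, δ ≤ a → ¬ (MA (p a b)).Countable := fun a ha b hδa hcount =>
    hδa.not_gt (hclosed (p a b, ⊥) (hpδ a b) h0 a
      (Or.inl (Or.inl (Or.inl ⟨⟨ha, fun x hx => (hpval a b x hx).1⟩, hcount⟩))))
  refine ⟨δ, h0, hlim, ?_, ?_, ?_⟩
  · intro a ha b hb hδa hδb
    have hfin : {ξ | ξ < δ ∧ C.weight ξ b ≠ C.weight ξ a}.Finite := by
      refine ((C.finite_weight_ne hδa).union (C.finite_weight_ne hδb)).subset ?_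
      rintro ξ ⟨hξ, hne⟩
      by_contra hcon
      simp only [Set.mem_union, Set.mem_ofPred_eq, not_or, not_and, not_not] at hcon
      exact hne ((hcon.2 hξ).symm.trans (hcon.1 hξ))
    obtain ⟨γ, hγ, hγG⟩ := C.exists_ladder_gt h0 hlim (hfin.union (C.finite_trace δ b)) (by
      rintro x (hx | hx)
      · exact hx.1
      · exact C.lt_of_mem_trace hx)
    have hγδ := C.lt_of_mem hγ
    have hmem : δ ∈ SE (p a b, γ) := by
      refine ⟨hγ, a, ha, b, hb, hδa, hδb, hptrace a b, hpval a b, fun ξ hγξ hξ => ?_⟩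
      by_contra hne
      exact (hγG ξ (Or.inl ⟨hξ, hne⟩)).not_ge hγξ
    have hunc : ¬ (SE (p a b, γ)).Countable := fun hcount =>
      lt_irrefl δ (hclosed (p a b, γ) (hpδ a b) hγδ δ
        (Or.inl (Or.inl (Or.inr ⟨hmem, hcount⟩))))
    obtain ⟨δ', ⟨hγ', a', ha', b', hb', hδa', hδb', htr, hval, heq⟩, hδδ'⟩ :=
      exists_gt_of_not_countable hc hunc δ
    obtain ⟨h1, h2, h3, h4⟩ := C.trace_end_extension h0 hγ' hγδ hδδ' hδb'
      (htr.trans (hptrace a b).symm) fun x hx => hγG x (Or.inr hx)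
    exact ⟨a', ha', b', hb', hδδ'.le.trans hδa', hδδ'.le.trans hδb', _, h2, C.finite_trace _ _, h1,
      h4, fun x hx => hval _ (hpmem a b x hx), fun x hx => heq x (h3 x hx).1 ((h3 x hx).2.trans hδδ')⟩
  · intro a ha b hb hδa hδb
    have hgδ : g (p a b) < δ := hclosed (p a b, ⊥) (hpδ a b) h0 _ (Or.inr (Or.inl rfl))
    obtain ⟨γ, hγ, hγG⟩ := C.exists_ladder_gt h0 hlim ((C.finite_trace δ b).insert (g (p a b))) (by
      rintro x (rfl | hx)
      · exact hgδ
      · exact C.lt_of_mem_trace hx)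
    have hγδ := C.lt_of_mem hγ
    have hmem : δ ∈ SG (p a b, γ) :=
      ⟨hγ, b, hb, hδb, hptrace a b, fun x hx => (hpval a b x hx).2⟩
    have hunc : ¬ (SG (p a b, γ)).Countable := fun hcount =>
      lt_irrefl δ (hclosed (p a b, γ) (hpδ a b) hγδ δ (Or.inl (Or.inr ⟨hmem, hcount⟩)))
    obtain ⟨δ', ⟨hγ', b', hb', hδb', htr, hval⟩, hδδ'⟩ := exists_gt_of_not_countable hc hunc δ
    obtain ⟨h1, h2, h3, h4⟩ := C.trace_end_extension h0 hγ' hγδ hδδ' hδb'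
      (htr.trans (hptrace a b).symm) fun x hx => hγG x (Or.inr hx)
    obtain ⟨n, hn⟩ := ((C.finite_trace δ δ').image fun ξ => C.weight ξ b').bddAbove
    obtain ⟨a', ⟨ha', hval'⟩, hδa', hwt⟩ := hg (p a b) (hMA a ha b hδa) (C.trace δ δ')
      (C.finite_trace _ _) (fun x hx => (hγG _ (Or.inl rfl)).le.trans (h3 x hx).1) n δ
    exact ⟨a', ha', b', hb', hδa'.le, hδδ'.le.trans hδb', _, h2, C.finite_trace _ _, h1, h4,
      fun x hx => ⟨hval' _ (hpmem a b x hx), hval _ (hpmem a b x hx)⟩,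
      fun x hx => (hn (Set.mem_image_of_mem _ hx)).trans_lt (hwt x hx)⟩
  · intro a ha b hb hδa hδb γ hγ
    obtain ⟨⟨hαA, hα⟩, hγα⟩ := hu (p a b, γ) (hMA a ha b hδa)
    exact ⟨_, hαA, hγα, hclosed (p a b, γ) (hpδ a b) hγ _ (Or.inr (Or.inr rfl)),
      fun x hx => hα _ (hpmem a b x hx)⟩

/-- The elements at which the weight towards `a` exceeds the weight towards `b`. -/
def above (a b : W) : Set W := {ξ | C.weight ξ b < C.weight ξ a}

omit [Uncountable W] in
theorem mem_above {a b : W} : ξ ∈ C.above a b ↔ C.weight ξ b < C.weight ξ a := Iff.rfl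

omit [Uncountable W] in
theorem EndExtends.trans_eq_lt {a b a' b' a'' b'' : W} (h1 : C.EndExtends (· = ·) δ a b a' b')
    (h2 : C.EndExtends (· < ·) δ a' b' a'' b'') :
    C.trace δ b ⊆ C.trace δ b'' ∧ (∀ x ∈ C.trace δ b, C.weight x a'' = C.weight x a) ∧
      (∃ μ ∈ C.trace δ b'', μ ∈ C.above a'' b'' ∧ ∀ ζ ∈ C.trace δ b'', ζ ≤ μ) ∧
      ((∃ μ ∈ C.trace δ b, μ ∈ C.above a b ∧ ∀ ζ ∈ C.trace δ b, ζ ≤ μ) →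
        (oscillation (C.above a'' b'') (C.trace δ b'')).ncard =
          (oscillation (C.above a b) (C.trace δ b)).ncard + 1) := by
  obtain ⟨F, hF0, hF, hTF, hltF, hagF, hRF⟩ := h1
  obtain ⟨G, hG0, hG, hTG, hltG, hagG, hRG⟩ := h2
  rw [hTF] at hTG hltG hagG
  have hT := C.finite_trace δ b
  have hwa : ∀ x ∈ C.trace δ b, C.weight x a'' = C.weight x a := fun x hx =>
    (hagG x (Or.inl hx)).1.trans (hagF x hx).1
  have hwb : ∀ x ∈ C.trace δ b, C.weight x b'' = C.weight x b := fun x hx =>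
    (hagG x (Or.inl hx)).2.trans (hagF x hx).2
  have habove : ∀ x ∈ C.trace δ b, x ∈ C.above a'' b'' ↔ x ∈ C.above a b := fun x hx => by
    rw [C.mem_above, C.mem_above, hwa x hx, hwb x hx]
  rw [hTG]
  refine ⟨fun x hx => Or.inl (Or.inl hx), hwa, ?_, ?_⟩
  · obtain ⟨μ, hμ, hmax⟩ := Set.exists_max_image G id hG hG0
    refine ⟨μ, Or.inr hμ, hRG μ hμ, ?_⟩
    rintro ζ (hζ | hζ)
    · exact (hltG ζ hζ μ hμ).le
    · exact hmax ζ hζ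
  · rintro ⟨μ, hμ, hμP, hmax⟩
    rw [Set.union_assoc, ncard_oscillation_union hT (hF.union hG) ?_
      ⟨μ, hμ, (habove μ hμ).2 hμP, hmax⟩, oscillation_congr habove,
      ncard_oscillation_eq_one (P := C.above a'' b'') hF hG hF0 hG0 (fun x hx => hltG x (Or.inr hx)) ?_ hRG]
    · intro x hx
      rw [C.mem_above, (hagG x (Or.inr hx)).1, (hagG x (Or.inr hx)).2, hRF x hx]
      exact lt_irrefl _
    · rintro x hx y (hy | hy)
      · exact hltF x hx y hy
      · exact hltG x (Or.inl hx) y hy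

/-- Moore's oscillation of the pair `(α, β)`. -/
noncomputable def osc (α β : W) : ℕ := (oscillation (C.above α β) (C.trace α β)).ncard

/-- Every product of two uncountable sets contains pairs of arbitrarily many consecutive
oscillations. -/
theorem exists_osc_eq_add (hc : ∀ a : W, (Set.Iio a).Countable) {A B : Set W}
    (hA : ¬ A.Countable) (hB : ¬ B.Countable) (n : ℕ) :
    ∃ α ∈ A, ∃ N : ℕ, ∀ m ≤ n, ∃ b ∈ B, C.osc α b = N + m := by
  obtain ⟨δ, h0, hlim, heq, hlt, hrefl⟩ := C.exists_reflecting hc A B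
  let State := {s : W × W // s.1 ∈ A ∧ s.2 ∈ B ∧ δ ≤ s.1 ∧ δ ≤ s.2}
  have hstep : ∀ s : State, ∃ t : State, ∃ a' b' : W,
      C.EndExtends (· = ·) δ s.1.1 s.1.2 a' b' ∧ C.EndExtends (· < ·) δ a' b' t.1.1 t.1.2 := by
    rintro ⟨⟨a, b⟩, ha, hb, hδa, hδb⟩
    obtain ⟨a', ha', b', hb', hδa', hδb', h1⟩ := heq a ha b hb hδa hδb
    obtain ⟨a'', ha'', b'', hb'', hδa'', hδb'', h2⟩ := hlt a' ha' b' hb' hδa' hδb'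
    exact ⟨⟨(a'', b''), ha'', hb'', hδa'', hδb''⟩, a', b', h1, h2⟩
  choose f a' b' h1 h2 using hstep
  have hf := fun s : State => EndExtends.trans_eq_lt C (h1 s) (h2 s)
  obtain ⟨a₀, ha₀, hδa₀⟩ := exists_gt_of_not_countable hc hA δ
  obtain ⟨b₀, hb₀, hδb₀⟩ := exists_gt_of_not_countable hc hB δ
  let s : ℕ → State := fun m => f^[m + 1] ⟨(a₀, b₀), ha₀, hb₀, hδa₀.le, hδb₀.le⟩
  have hs : ∀ m, s (m + 1) = f (s m) := fun m => Function.iterate_succ_apply' f (m + 1) _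
  let T : ℕ → Set W := fun m => C.trace δ (s m).1.2
  have htop : ∀ m, ∃ μ ∈ T m, μ ∈ C.above (s m).1.1 (s m).1.2 ∧ ∀ ζ ∈ T m, ζ ≤ μ := by
    intro m
    have : s m = f (f^[m] ⟨(a₀, b₀), ha₀, hb₀, hδa₀.le, hδb₀.le⟩) :=
      Function.iterate_succ_apply' f m _
    simp only [T, this]
    exact (hf _).2.2.1
  have hcount : ∀ m, (oscillation (C.above (s m).1.1 (s m).1.2) (T m)).ncard =
      (oscillation (C.above (s 0).1.1 (s 0).1.2) (T 0)).ncard + m := by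
    intro m
    induction m with
    | zero => rfl
    | succ m ih =>
      rw [← add_assoc, ← ih]
      simp only [T, hs m]
      exact (hf (s m)).2.2.2 (htop m)
  have hext : ∀ m k, T m ⊆ T (m + k) ∧
      ∀ x ∈ T m, C.weight x (s (m + k)).1.1 = C.weight x (s m).1.1 := by
    intro m k
    induction k with
    | zero => exact ⟨subset_rfl, fun x _ => rfl⟩
    | succ k ih =>
      have h := hf (s (m + k))
      rw [← hs] at h
      exact ⟨ih.1.trans h.1, fun x hx => (h.2.1 x (ih.1 hx)).trans (ih.2 x hx)⟩
  have hdiff : (T n ∪ ⋃ m ∈ Set.Iic n,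
      {ξ | ξ < δ ∧ C.weight ξ δ ≠ C.weight ξ (s m).1.2}).Finite :=
    (C.finite_trace _ _).union
      ((Set.finite_Iic n).biUnion fun m _ => C.finite_weight_ne (s m).2.2.2.2)
  obtain ⟨γ, hγ, hγlt⟩ := C.exists_ladder_gt h0 hlim hdiff (by
    rintro x (hx | hx)
    · exact C.lt_of_mem_trace hx
    · obtain ⟨m, _, hx⟩ := Set.mem_iUnion₂.1 hx
      exact hx.1)
  obtain ⟨α, hαA, hγα, hαδ, hα⟩ := hrefl _ (s n).2.1 _ (s n).2.2.1 (s n).2.2.2.1 (s n).2.2.2.2 γ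
    (C.lt_of_mem hγ)
  have hα0 : ⊥ < α := bot_le.trans_lt hγα
  have hge : ∀ x ∈ C.trace α δ, γ ≤ x := fun x hx => C.le_of_mem_trace hx hγ hγα
  refine ⟨α, hαA, (oscillation (C.above (s 0).1.1 (s 0).1.2) (T 0)).ncard +
    (oscillation (C.above α δ) (C.trace α δ)).ncard, fun m hm => ⟨_, (s m).2.2.1, ?_⟩⟩
  obtain ⟨k, rfl⟩ := Nat.exists_eq_add_of_le hm
  have hsep : ∀ x ∈ T m, ∀ y ∈ C.trace α δ, x < y := fun x hx y hy =>
    (hγlt x (Or.inl ((hext m k).1 hx))).trans_le (hge y hy)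
  have hTα : ∀ x ∈ T m, x ∈ C.above α (s m).1.2 ↔ x ∈ C.above (s m).1.1 (s m).1.2 := by
    intro x hx
    rw [C.mem_above, C.mem_above, hα x ((hext m k).1 hx), (hext m k).2 x hx]
  have hδα : ∀ x ∈ C.trace α δ, x ∈ C.above α (s m).1.2 ↔ x ∈ C.above α δ := by
    intro x hx
    have hw : C.weight x δ = C.weight x (s m).1.2 := by
      by_contra hne
      exact (hγlt x (Or.inr (Set.mem_biUnion (Set.mem_Iic.2 hm)
        ⟨(C.lt_of_mem_trace hx).trans hαδ, hne⟩))).not_ge (hge x hx)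
    rw [C.mem_above, C.mem_above, hw]
  obtain ⟨μ, hμ, hμP, hmax⟩ := htop m
  rw [osc, C.trace_eq_union hα0 hαδ (s m).2.2.2.2 hsep,
    ncard_oscillation_union (C.finite_trace _ _) (C.finite_trace _ _) hsep
      ⟨μ, hμ, (hTα μ hμ).2 hμP, hmax⟩, oscillation_congr hTα, oscillation_congr hδα]
  have := hcount m
  simp only [T] at this ⊢
  omega

end Uncountable

end LadderSystem

theorem exists_padicValNat_two_eq (N j : ℕ) :
    ∃ m ≤ 2 ^ (j + 1), padicValNat 2 (N + m) = j := by
  let q := N / 2 ^ (j + 1)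
  have hpos : 0 < 2 ^ (j + 1) := by positivity
  have hdiv : 2 ^ (j + 1) * q + N % 2 ^ (j + 1) = N := Nat.div_add_mod _ _
  have hmod : N % 2 ^ (j + 1) < 2 ^ (j + 1) := Nat.mod_lt _ hpos
  have hval : ∀ r : ℕ, padicValNat 2 (2 ^ j * (2 * r + 1)) = j := by
    intro r
    rw [padicValNat.mul (by positivity) (by omega), padicValNat.prime_pow,
      padicValNat.eq_zero_of_not_dvd (by omega), add_zero]
  have hpow : 2 ^ (j + 1) = 2 * 2 ^ j := by ring
  rcases le_or_gt (N % 2 ^ (j + 1)) (2 ^ j) with h | h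
  · refine ⟨2 ^ j - N % 2 ^ (j + 1), by omega, ?_⟩
    have : N + (2 ^ j - N % 2 ^ (j + 1)) = 2 ^ j * (2 * q + 1) := by
      have : 2 ^ j * (2 * q + 1) = 2 ^ (j + 1) * q + 2 ^ j := by ring
      omega
    rw [this]
    exact hval q
  · refine ⟨2 ^ (j + 1) + 2 ^ j - N % 2 ^ (j + 1), by omega, ?_⟩
    have : N + (2 ^ (j + 1) + 2 ^ j - N % 2 ^ (j + 1)) = 2 ^ j * (2 * (q + 1) + 1) := by
      have : 2 ^ j * (2 * (q + 1) + 1) = 2 ^ (j + 1) * q + 2 ^ (j + 1) + 2 ^ j := by ring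
      omega
    rw [this]
    exact hval (q + 1)

/-- There is a map `ω₁ × ω₁ → ω` which is surjective on every product of uncountable sets. -/
theorem exists_forall_uncountable_prod_surjOn {X : Type*} {Y : Type*} (hX : #X = aleph 1)
    (hY : #Y = aleph 1) :
    ∃ c : X → Y → ℕ, ∀ (A : Set X) (B : Set Y), ¬ A.Countable → ¬ B.Countable →
      ∀ j, ∃ x ∈ A, ∃ y ∈ B, c x y = j := by
  let W : Type := (aleph.{0} 1).ord.ToType
  have hW : #W = aleph.{0} 1 := mk_ord_toType _
  have hc : ∀ a : W, (Set.Iio a).Countable := fun a => by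
    rw [← le_aleph0_iff_set_countable, ← Order.lt_succ_iff, succ_aleph0]
    exact (mk_Iio_lt a (by rw [hW, Ordinal.type_toType])).trans_eq hW
  have hunc : Uncountable W := by
    rw [← aleph0_lt_mk_iff, hW]
    exact aleph0_lt_aleph_one
  obtain ⟨eX⟩ : Nonempty (X ≃ W) := lift_mk_eq'.1 (by rw [hX, hW]; simp)
  obtain ⟨eY⟩ : Nonempty (Y ≃ W) := lift_mk_eq'.1 (by rw [hY, hW]; simp)
  have : Nonempty W := inferInstance
  let _ : OrderBot W := WellFoundedLT.toOrderBot W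
  obtain ⟨C⟩ := LadderSystem.nonempty_of_countable_Iio hc
  refine ⟨fun x y => padicValNat 2 (C.osc (eX x) (eY y)), fun A B hA hB j => ?_⟩
  have hA' : ¬ (eX '' A).Countable := fun h =>
    hA (Set.countable_of_injective_of_countable_image eX.injective.injOn h)
  have hB' : ¬ (eY '' B).Countable := fun h =>
    hB (Set.countable_of_injective_of_countable_image eY.injective.injOn h)
  obtain ⟨_, ⟨x, hx, rfl⟩, N, hN⟩ := C.exists_osc_eq_add hc hA' hB' (2 ^ (j + 1))
  obtain ⟨m, hm, hval⟩ := exists_padicValNat_two_eq N j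
  obtain ⟨_, ⟨y, hy, rfl⟩, hosc⟩ := hN m hm
  exact ⟨x, hx, y, hy, by simp only [hosc, hval]⟩

theorem Isodyne.not_countable {X : Type*} [TopologicalSpace X] (hX : Isodyne X)
    (hcX : #X = aleph 1) {U : Set X} (hU : IsOpen U) (hne : U.Nonempty) : ¬ U.Countable := by
  rw [← le_aleph0_iff_set_countable, hX U hU hne, hcX, not_le]
  exact aleph0_lt_aleph_one

/-- The product of any two regular isodyne spaces of cardinality `ω₁` is `ω`-resolvable. -/
theorem product_of_regular_isodyne_aleph_one_spaces_is_omega_resolvable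
    {X Y : Type*} [TopologicalSpace X] [TopologicalSpace Y]
    [RegularSpace X] [RegularSpace Y]
    (hX : Isodyne X) (hY : Isodyne Y)
    (hcX : #X = aleph 1) (hcY : #Y = aleph 1) :
    IsResolvable ℵ₀ (X × Y) := by
  obtain ⟨c, hsurj⟩ := exists_forall_uncountable_prod_surjOn hcX hcY
  let D : ℕ → Set (X × Y) := fun j => {p | c p.1 p.2 = j}
  have hdense : ∀ j, Dense (D j) := by
    intro j
    rw [dense_iff_inter_open]
    rintro U hU ⟨⟨x, y⟩, hxy⟩
    obtain ⟨V, V', hV, hV', hx, hy, hsub⟩ := isOpen_prod_iff.1 hU x y hxy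
    obtain ⟨x', hx', y', hy', hj⟩ :=
      hsurj V V' (hX.not_countable hcX hV ⟨x, hx⟩) (hY.not_countable hcY hV' ⟨y, hy⟩) j
    exact ⟨(x', y'), hsub ⟨hx', hy'⟩, hj⟩
  have hdisj : ∀ i j p, p ∈ D i → p ∈ D j → i = j := fun i j p hi hj => hi.symm.trans hj
  have : Nonempty X := mk_ne_zero_iff.1 (hcX ▸ (aleph_pos 1).ne')
  have : Nonempty Y := mk_ne_zero_iff.1 (hcY ▸ (aleph_pos 1).ne')
  have hinj : Function.Injective D := by
    intro i j hij
    obtain ⟨p, hp⟩ := (hdense i).nonempty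
    exact hdisj i j p hp (hij ▸ hp)
  refine ⟨Set.range D, ?_, ?_, ?_⟩
  · have := mk_range_eq_of_injective hinj
    simpa using this
  · rintro _ ⟨i, rfl⟩ _ ⟨j, rfl⟩ hij
    exact Set.disjoint_left.2 fun p hi hj => hij (congrArg D (hdisj i j p hi hj))
  · rintro _ ⟨j, rfl⟩
    exact hdense j
end

section
/- For every natural number n, the product of any n+2 Hausdorff isodyne topological spaces, each of cardinality ω_n (the n-th infinite cardinal ℵ_n), is ω-resolvable, i.e. it admits countably many pairwise disjoint dense subsets. -/
open Cardinal Topology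

/-- On a countable Hausdorff space, assign to each point the finite set of (codes of) points whose
chosen neighbourhood contains it. Every crowded set can be shrunk so that these sets agree up to a
prescribed level and have a gap below that level. -/
lemma exists_stabilizing_traces (Y : Type*) [TopologicalSpace Y] [T2Space Y] [Countable Y] :
    ∃ (a : Y → ℕ) (s : Y → Finset ℕ), (∀ y, a y ∈ s y) ∧ (∀ y, ∀ j ∈ s y, j ≤ a y) ∧
      ∀ V : Set Y, Preperfect V → ∀ y ∈ V, ∀ L, a y ≤ L →
        ∃ V' ⊆ V, Preperfect V' ∧ V'.Nonempty ∧ ∃ E : Finset ℕ, s y ⊆ E ∧ (∀ j ∈ E, j ≤ a y) ∧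
          ∀ v ∈ V', (s v).filter (· ≤ L) = E ∧ L < a v := by
  classical
  obtain ⟨a, ha⟩ := Countable.exists_injective_nat Y
  have hfin : ∀ L, {x | a x ≤ L}.Finite := fun L =>
    (Set.finite_Iic L).preimage ha.injOn
  have hA : ∀ x, ∃ A : Set Y, IsOpen A ∧ x ∈ A ∧ ∀ y, a y < a x → y ∉ closure A := by
    intro x
    have hsep : ∀ y, ∃ u : Set Y, IsOpen u ∧ x ∈ u ∧ (a y < a x → y ∉ closure u) := by
      intro y
      by_cases hy : a y < a x
      · have hne : x ≠ y := by rintro rfl; exact lt_irrefl _ hy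
        obtain ⟨u, v, hu, hv, hxu, hyv, hd⟩ := t2_separation hne
        refine ⟨u, hu, hxu, fun _ hyu => ?_⟩
        exact Set.disjoint_left.1 (hd.closure_left hv) hyu hyv
      · exact ⟨Set.univ, isOpen_univ, trivial, fun h => absurd h hy⟩
    choose u hu hxu hyu using hsep
    refine ⟨⋂ y ∈ {y | a y ≤ a x}, u y, (hfin (a x)).isOpen_biInter fun y _ => hu y,
      Set.mem_iInter₂.2 fun y _ => hxu y, fun y hy hmem => hyu y hy ?_⟩
    exact closure_mono (Set.biInter_subset_of_mem (show y ∈ {y | a y ≤ a x} from hy.le)) hmem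
  choose A hAo hAx hAc using hA
  have hAle : ∀ x y, y ∈ A x → a x ≤ a y := fun x y h => by
    by_contra! hlt
    exact hAc x y hlt (subset_closure h)
  let s : Y → Finset ℕ := fun y => (Finset.range (a y + 1)).filter fun j => ∃ x, a x = j ∧ y ∈ A x
  have hs : ∀ y j, j ∈ s y ↔ ∃ x, a x = j ∧ y ∈ A x := by
    intro y j
    simp only [s, Finset.mem_filter, Finset.mem_range, and_iff_right_iff_imp]
    rintro ⟨x, rfl, hx⟩
    have := hAle x y hx
    omega
  have hs_open : ∀ j, IsOpen {y | j ∈ s y} := by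
    intro j
    have : {y | j ∈ s y} = ⋃ x ∈ {x | a x = j}, A x := by
      ext y; simp [hs]
    rw [this]
    exact isOpen_biUnion fun x _ => hAo x
  have hs_sup : ∀ E : Finset ℕ, IsOpen {y | E ⊆ s y} := by
    intro E
    have : {y | E ⊆ s y} = ⋂ j ∈ E, {y | j ∈ s y} := by
      ext y; simp [Finset.subset_iff]
    rw [this]
    exact isOpen_biInter_finset fun j _ => hs_open j
  have hsle : ∀ y, ∀ j ∈ s y, j ≤ a y := by
    intro y j hj
    obtain ⟨x, rfl, hx⟩ := (hs y j).1 hj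
    exact hAle x y hx
  refine ⟨a, s, fun y => (hs y _).2 ⟨y, rfl, hAx y⟩, hsle, ?_⟩
  intro V hV y hy L hL
  let O : Set Y := {v | s y ⊆ s v} ∩
    ((⋂ x ∈ {x | a x ≤ L} ∩ {x | a y < a x}, (closure (A x))ᶜ))
  have hO : IsOpen O := (hs_sup _).inter
    (((hfin L).subset Set.inter_subset_left).isOpen_biInter fun x _ => isClosed_closure.isOpen_compl)
  have hyO : y ∈ O := ⟨Finset.Subset.refl _, Set.mem_iInter₂.2 fun x hx => hAc x y hx.2⟩
  let O₁ : Set Y := O ∩ {x | a x ≤ L}ᶜ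
  have hO₁ : IsOpen O₁ := hO.inter (hfin L).isClosed.isOpen_compl
  have hne : (O₁ ∩ V).Nonempty := by
    have hN : O ∩ ({x | a x ≤ L} \ {y})ᶜ ∈ 𝓝 y := by
      refine (hO.inter ((hfin L).subset Set.sdiff_subset).isClosed.isOpen_compl).mem_nhds ⟨hyO, ?_⟩
      simp
    obtain ⟨v, ⟨⟨hvO, hv⟩, hvV⟩, hvy⟩ := preperfect_iff_nhds.1 hV y hy _ hN
    exact ⟨v, ⟨hvO, fun h => hv ⟨h, hvy⟩⟩, hvV⟩
  let g : Y → ℕ := fun v => ((s v).filter (· ≤ L)).card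
  have hbdd : (g '' (O₁ ∩ V)).Finite := by
    refine (Set.finite_Iic (L + 1)).subset ?_
    rintro _ ⟨v, -, rfl⟩
    have : (s v).filter (· ≤ L) ⊆ Finset.range (L + 1) := by
      intro j hj
      simp only [Finset.mem_filter] at hj
      simp only [Finset.mem_range]
      omega
    simpa [g] using Finset.card_le_card this
  obtain ⟨_, ⟨w, hw, rfl⟩, hmax⟩ := hbdd.exists_maximal (hne.image g)
  refine ⟨{v | (s w).filter (· ≤ L) ⊆ s v} ∩ O₁ ∩ V, Set.inter_subset_right,
    hV.open_inter ((hs_sup _).inter hO₁), ⟨w, ⟨Finset.filter_subset _ _, hw.1⟩, hw.2⟩,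
    (s w).filter (· ≤ L), ?_, ?_, ?_⟩
  · intro j hj
    exact Finset.mem_filter.2 ⟨hw.1.1.1 hj, (hsle y j hj).trans hL⟩
  · intro j hj
    obtain ⟨hj, hjL⟩ := Finset.mem_filter.1 hj
    obtain ⟨x, rfl, hx⟩ := (hs w j).1 hj
    by_contra! hlt
    exact Set.mem_iInter₂.1 hw.1.1.2 x ⟨hjL, hlt⟩ (subset_closure hx)
  · rintro v ⟨⟨hsub, hv⟩, hvV⟩
    have hsub' : (s w).filter (· ≤ L) ⊆ (s v).filter (· ≤ L) := fun j hj =>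
      Finset.mem_filter.2 ⟨hsub hj, (Finset.mem_filter.1 hj).2⟩
    refine ⟨(Finset.eq_of_subset_of_card_le hsub' ?_).symm, not_le.1 hv.2⟩
    exact hmax ⟨v, ⟨hv, hvV⟩, rfl⟩ (Finset.card_le_card hsub')

/-- The number of distinct initial segments of `S` cut off by elements of `T`. -/
def cutCount (S T : Finset ℕ) : ℕ :=
  (T.image fun t => S.filter (· < t)).card

lemma cutCount_eq_succ {S T E F : Finset ℕ} {J K p q : ℕ} (hE : S.filter (· ≤ J) = E)
    (hF : T.filter (· ≤ K) = F) (hFJ : ∀ t ∈ F, t ≤ J) (hSK : ∀ j ∈ S, j ≤ K)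
    (hp : p ∈ S) (hJp : J < p) (hq : q ∈ T) (hKq : K < q) :
    cutCount S T = cutCount E F + 1 := by
  classical
  have himage : (T.image fun t => S.filter (· < t)) =
      insert S (F.image fun t => E.filter (· < t)) := by
    have hlow : ∀ t ∈ F, S.filter (· < t) = E.filter (· < t) := by
      intro t ht
      have := hFJ t ht
      subst hE
      ext j
      simp only [Finset.mem_filter]
      constructor
      · rintro ⟨h1, h2⟩; exact ⟨⟨h1, by omega⟩, h2⟩
      · rintro ⟨⟨h1, -⟩, h2⟩; exact ⟨h1, h2⟩
    have hhigh : ∀ t, K < t → S.filter (· < t) = S := by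
      intro t ht
      exact Finset.filter_true_of_mem fun j hj => (hSK j hj).trans_lt ht
    ext B
    simp only [Finset.mem_image, Finset.mem_insert]
    constructor
    · rintro ⟨t, ht, rfl⟩
      by_cases htK : t ≤ K
      · have htF : t ∈ F := hF ▸ Finset.mem_filter.2 ⟨ht, htK⟩
        exact Or.inr ⟨t, htF, (hlow t htF).symm⟩
      · exact Or.inl (hhigh t (not_le.1 htK))
    · rintro (rfl | ⟨t, ht, rfl⟩)
      · exact ⟨q, hq, hhigh q hKq⟩
      · have htT : t ∈ T := by
          rw [← hF] at ht
          exact (Finset.mem_filter.1 ht).1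
        exact ⟨t, htT, hlow t ht⟩
  rw [cutCount, himage, Finset.card_insert_of_notMem, cutCount]
  intro hmem
  obtain ⟨t, -, ht⟩ := Finset.mem_image.1 hmem
  have hpE : p ∈ E := (Finset.mem_filter.1 (ht.symm ▸ hp : p ∈ E.filter (· < t))).1
  rw [← hE] at hpE
  have := (Finset.mem_filter.1 hpE).2
  omega

lemma exists_coloring_of_countable (Y Z : Type*) [TopologicalSpace Y] [T2Space Y] [Countable Y]
    [TopologicalSpace Z] [T2Space Z] [Countable Z] :
    ∃ c : Y → Z → ℕ, ∀ (V : Set Y) (W : Set Z), Preperfect V → V.Nonempty → Preperfect W →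
      W.Nonempty → ∀ k, ∃ y ∈ V, ∃ z ∈ W, c y z = k := by
  obtain ⟨a, s, has, hsa, hY⟩ := exists_stabilizing_traces Y
  obtain ⟨b, r, hbr, hrb, hZ⟩ := exists_stabilizing_traces Z
  refine ⟨fun y z => (Nat.unpair (cutCount (s y) (r z))).2, ?_⟩
  intro V W hV ⟨y₀, hy₀⟩ hW ⟨z₀, hz₀⟩ k
  have hstate : ∃ N, ∀ m, ∃ V' ⊆ V, ∃ W' ⊆ W, ∃ (y : Y) (J K : ℕ) (E F : Finset ℕ),
      Preperfect V' ∧ Preperfect W' ∧ W'.Nonempty ∧ y ∈ V' ∧ J < a y ∧ a y ≤ K ∧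
      (∀ v ∈ V', (s v).filter (· ≤ J) = E) ∧
      (∀ w ∈ W', (r w).filter (· ≤ K) = F ∧ K < b w) ∧ (∀ t ∈ F, t ≤ J) ∧
      cutCount E F = N + m := by
    obtain ⟨V₁, hV₁, hV₁p, ⟨y₁, hy₁⟩, E, -, -, hE⟩ :=
      hY V hV y₀ hy₀ (max (a y₀) (b z₀)) (le_max_left _ _)
    have hlt := (hE y₁ hy₁).2
    obtain ⟨W₁, hW₁, hW₁p, hW₁n, F, -, hFle, hF⟩ :=
      hZ W hW z₀ hz₀ (a y₁) ((le_max_right _ _).trans hlt.le)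
    refine ⟨cutCount E F, fun m => ?_⟩
    induction m with
    | zero =>
      exact ⟨V₁, hV₁, W₁, hW₁, y₁, _, _, E, F, hV₁p, hW₁p, hW₁n, hy₁, hlt, le_rfl,
        fun v hv => (hE v hv).1, hF, fun t ht => (hFle t ht).trans (le_max_right _ _), rfl⟩
    | succ m ih =>
      obtain ⟨V', hV', W', hW', y, J, K, E, F, hV'p, hW'p, ⟨z, hz⟩, hy, hJ, hK, hE, hF, hFJ, hc⟩ :=
        ih
      have hKz := (hF z hz).2
      obtain ⟨V'', hV'', hV''p, ⟨y', hy'⟩, E', hyE, hE'le, hE'⟩ :=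
        hY V' hV'p y hy (b z) (hK.trans hKz.le)
      have hlt' := (hE' y' hy').2
      obtain ⟨W'', hW'', hW''p, ⟨z', hz'⟩, F', hzF, hF'le, hF'⟩ :=
        hZ W' hW'p z hz (a y') hlt'.le
      refine ⟨V'', hV''.trans hV', W'', hW''.trans hW', y', b z, a y', E', F', hV''p, hW''p,
        ⟨z', hz'⟩, hy', hlt', le_rfl, fun v hv => (hE' v hv).1, hF', hF'le, ?_⟩
      rw [← add_assoc, ← hc]
      refine cutCount_eq_succ (J := J) (K := K) (p := a y) (q := b z) ?_ ?_ hFJ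
        (fun j hj => (hE'le j hj).trans hK) (hyE (has y)) hJ (hzF (hbr z)) hKz
      · rw [← (hE' y' hy').1, ← hE y' (hV'' hy'), Finset.filter_filter]
        exact Finset.filter_congr fun j _ => by omega
      · rw [← (hF' z' hz').1, ← (hF z' (hW'' hz')).1, Finset.filter_filter]
        exact Finset.filter_congr fun j _ => by omega
  obtain ⟨N, hN⟩ := hstate
  have hle : N + 1 ≤ Nat.pair (N + 1) k := Nat.left_le_pair _ _
  obtain ⟨V', hV', W', hW', y, J, K, E, F, -, -, ⟨z, hz⟩, hy, hJ, hK, hE, hF, hFJ, hc⟩ :=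
    hN (Nat.pair (N + 1) k - (N + 1))
  refine ⟨y, hV' hy, z, hW' hz, ?_⟩
  have hcut := cutCount_eq_succ (hE y hy) (hF z hz).1 hFJ (fun j hj => (hsa y j hj).trans hK)
    (has y) hJ (hbr z) (hF z hz).2
  have : cutCount (s y) (r z) = Nat.pair (N + 1) k := by omega
  simp [this]

lemma exists_countable_preperfect_subset {Y : Type*} [TopologicalSpace Y]
    [SecondCountableTopology Y] {A : Set Y} (hA : ¬ A.Countable) :
    ∃ D ⊆ A, D.Countable ∧ D.Nonempty ∧ Preperfect D := by
  let 𝓑 := TopologicalSpace.countableBasis Y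
  have h𝓑 : 𝓑.Countable := TopologicalSpace.countable_countableBasis Y
  let R : Set Y := ⋃ b ∈ {b ∈ 𝓑 | (b ∩ A).Countable}, b ∩ A
  have hR : R.Countable := (h𝓑.mono (Set.sep_subset _ _)).biUnion fun b hb => hb.2
  have hbig : ∀ b ∈ 𝓑, (b ∩ (A \ R)).Nonempty → ¬ (b ∩ (A \ R)).Countable := by
    rintro b hb ⟨x, hxb, hxA, hxR⟩ hcount
    refine hxR (Set.mem_biUnion (show b ∈ {b ∈ 𝓑 | (b ∩ A).Countable} from ⟨hb, ?_⟩) ⟨hxb, hxA⟩)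
    refine (hcount.union hR).mono ?_
    rintro y ⟨hyb, hyA⟩
    by_cases hy : y ∈ R
    · exact Or.inr hy
    · exact Or.inl ⟨hyb, hyA, hy⟩
  have hpair : ∀ b : {b ∈ 𝓑 | (b ∩ (A \ R)).Nonempty}, ∃ p q, p ∈ b.1 ∩ (A \ R) ∧
      q ∈ b.1 ∩ (A \ R) ∧ p ≠ q := by
    rintro ⟨b, hb, hne⟩
    have : (b ∩ (A \ R)).Nontrivial := by
      rw [← Set.not_subsingleton_iff]
      exact fun h => hbig b hb hne h.countable
    obtain ⟨p, hp, q, hq, hpq⟩ := this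
    exact ⟨p, q, hp, hq, hpq⟩
  choose p q hp hq hpq using hpair
  have : Countable {b ∈ 𝓑 | (b ∩ (A \ R)).Nonempty} := (h𝓑.mono (Set.sep_subset _ _)).to_subtype
  have hsub : Set.range p ∪ Set.range q ⊆ A \ R := by
    rintro _ (⟨b, rfl⟩ | ⟨b, rfl⟩)
    · exact (hp b).2
    · exact (hq b).2
  have hbasis : ∀ x ∈ A \ R, ∀ U ∈ 𝓝 x, ∃ b : {b ∈ 𝓑 | (b ∩ (A \ R)).Nonempty}, b.1 ⊆ U := by
    intro x hx U hU
    obtain ⟨b, hb, hxb, hbU⟩ :=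
      (TopologicalSpace.isBasis_countableBasis Y).mem_nhds_iff.1 hU
    exact ⟨⟨b, hb, x, hxb, hx⟩, hbU⟩
  refine ⟨Set.range p ∪ Set.range q, hsub.trans Set.sdiff_subset,
    (Set.countable_range p).union (Set.countable_range q), ?_, ?_⟩
  · have hne : (A \ R).Nonempty := by
      rw [Set.nonempty_iff_ne_empty]
      intro h
      exact hA (hR.mono (Set.sdiff_eq_empty.1 h))
    obtain ⟨x, hx⟩ := hne
    obtain ⟨b, -⟩ := hbasis x hx Set.univ Filter.univ_mem
    exact ⟨p b, Or.inl ⟨b, rfl⟩⟩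
  · rw [preperfect_iff_nhds]
    intro x hx U hU
    obtain ⟨b, hb⟩ := hbasis x (hsub hx) U hU
    by_cases h : p b = x
    · exact ⟨q b, ⟨hb (hq b).1, Or.inr ⟨b, rfl⟩⟩, fun h' => hpq b (h.trans h'.symm)⟩
    · exact ⟨p b, ⟨hb (hp b).1, Or.inl ⟨b, rfl⟩⟩, h⟩

lemma exists_small_segments (n : ℕ) (Ω : Type*) (hΩ : #Ω = aleph (n + 1 : ℕ)) :
    ∃ I : Ω → Set Ω, (∀ x, #(I x) ≤ aleph n) ∧
      ∀ A B : Set Ω, #A = aleph (n + 1 : ℕ) → #B ≤ aleph n → ∃ x ∈ A, B ⊆ I x := by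
  have hsucc : aleph (n + 1 : ℕ) = Order.succ (aleph n) := by
    rw [Nat.cast_succ, succ_aleph]
  obtain ⟨e⟩ : Nonempty (Ω ≃ (aleph.{_} (n + 1 : ℕ)).ord.ToType) := by
    rw [← Cardinal.eq, hΩ, mk_ord_toType]
  have hI : ∀ x, #{y | e y < e x} ≤ aleph n := by
    intro x
    rw [← Order.lt_succ_iff, ← hsucc]
    refine lt_of_le_of_lt ?_ ((mk_Iio_lt (e x) (by simp)).trans_eq (mk_ord_toType _))
    exact mk_le_of_injective (f := fun y : {y | e y < e x} => (⟨e y, y.2⟩ : Set.Iio (e x)))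
      fun y z h => Subtype.ext (e.injective (congrArg Subtype.val h))
  refine ⟨fun x => {y | e y < e x}, hI, ?_⟩
  intro A B hA hB
  by_contra! hcon
  have hsub : A ⊆ ⋃ b : B, ({y | e y < e b} ∪ {b.1}) := by
    intro x hx
    obtain ⟨b, hb, hbx⟩ := Set.not_subset.1 (hcon x hx)
    refine Set.mem_iUnion.2 ⟨⟨b, hb⟩, ?_⟩
    have hxb : e x ≤ e b := not_lt.1 hbx
    rcases hxb.lt_or_eq with h | h
    · exact Or.inl h
    · exact Or.inr (e.injective h)
  have hcard : #A ≤ aleph n := by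
    refine (mk_le_mk_of_subset hsub).trans ((mk_iUnion_le _).trans ?_)
    refine (mul_le_mul' hB (ciSup_le' fun b => (mk_union_le _ _).trans
      (add_le_add (hI _) ?_))).trans (b := aleph n * (aleph n + aleph n)) ?_
    · rw [mk_singleton]
      exact one_le_aleph0.trans (aleph0_le_aleph _)
    · rw [add_eq_self (aleph0_le_aleph _), mul_eq_self (aleph0_le_aleph _)]
  rw [hA, hsucc] at hcard
  exact (Order.lt_succ _).not_ge hcard

lemma exists_coloring_aleph_one (Ω : Type*) (hΩ : #Ω = aleph (0 + 1 : ℕ)) :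
    ∃ F : (Fin 3 → Ω) → ℕ, ∀ A : Fin 3 → Set Ω, (∀ i, #(A i) = aleph (0 + 1 : ℕ)) →
      ∀ k, ∃ x, (∀ i, x i ∈ A i) ∧ F x = k := by
  classical
  obtain ⟨I, hI, hA⟩ := exists_small_segments 0 Ω hΩ
  simp only [Nat.cast_zero, aleph_zero, le_aleph0_iff_set_countable] at hI hA
  obtain ⟨g⟩ : Nonempty (Ω ↪ ULift (ℕ → Bool)) := by
    rw [← Cardinal.le_def, hΩ]
    simpa using aleph_one_le_continuum
  let : TopologicalSpace Ω := TopologicalSpace.induced g inferInstance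
  have hg : IsEmbedding g := ⟨⟨rfl⟩, g.injective⟩
  have : T2Space Ω := hg.t2Space
  have : SecondCountableTopology Ω := by
    have : SecondCountableTopology (ULift (ℕ → Bool)) :=
      (Homeomorph.ulift (X := ℕ → Bool)).secondCountableTopology
    exact hg.secondCountableTopology
  have : ∀ x, Countable (I x) := fun x => (hI x).to_subtype
  choose c hc using fun x => exists_coloring_of_countable (I x) (I x)
  refine ⟨fun x => if h : x 0 ∈ I (x 2) ∧ x 1 ∈ I (x 2) then c (x 2) ⟨x 0, h.1⟩ ⟨x 1, h.2⟩ else 0,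
    fun A hAcard k => ?_⟩
  have hunc : ∀ i, ¬ (A i).Countable := by
    intro i h
    rw [← le_aleph0_iff_set_countable, hAcard i] at h
    simp at h
  obtain ⟨D, hDA, hDc, hDn, hDp⟩ := exists_countable_preperfect_subset (hunc 0)
  obtain ⟨D', hDA', hDc', hDn', hDp'⟩ := exists_countable_preperfect_subset (hunc 1)
  obtain ⟨x, hx, hsub⟩ := hA (A 2) (D ∪ D') (hAcard 2) (hDc.union hDc')
  have hpre : ∀ C : Set Ω, C ⊆ I x → Preperfect C → Preperfect ((↑) ⁻¹' C : Set (I x)) := by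
    intro C hC hCp
    rw [preperfect_iff_nhds] at hCp ⊢
    intro y hy U hU
    obtain ⟨U', hU', hUU⟩ := mem_nhds_subtype _ _ _ |>.1 hU
    obtain ⟨w, ⟨hwU, hwC⟩, hwy⟩ := hCp y hy U' hU'
    exact ⟨⟨w, hC hwC⟩, ⟨hUU hwU, hwC⟩, fun h => hwy (congrArg Subtype.val h)⟩
  have hne : ∀ C : Set Ω, C ⊆ I x → C.Nonempty → ((↑) ⁻¹' C : Set (I x)).Nonempty :=
    fun C hC ⟨y, hy⟩ => ⟨⟨y, hC hy⟩, hy⟩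
  have hD := Set.subset_union_left.trans hsub
  have hD' := Set.subset_union_right.trans hsub
  obtain ⟨y, hy, z, hz, hyz⟩ := hc x _ _ (hpre D hD hDp) (hne D hD hDn) (hpre D' hD' hDp')
    (hne D' hD' hDn') k
  refine ⟨![y, z, x], ?_, ?_⟩
  · intro i
    fin_cases i
    exacts [hDA hy, hDA' hz, hx]
  · have h : (![y.1, z.1, x] : Fin 3 → Ω) 0 ∈ I x ∧ (![y.1, z.1, x] : Fin 3 → Ω) 1 ∈ I x :=
      ⟨y.2, z.2⟩
    exact (dif_pos h).trans hyz

lemma exists_coloring_aleph_succ (n : ℕ) (Ω : Type*) (hΩ : #Ω = aleph (n + 1 : ℕ)) :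
    ∃ F : (Fin (n + 3) → Ω) → ℕ, ∀ A : Fin (n + 3) → Set Ω,
      (∀ i, #(A i) = aleph (n + 1 : ℕ)) → ∀ k, ∃ x, (∀ i, x i ∈ A i) ∧ F x = k := by
  classical
  induction n generalizing Ω with
  | zero => exact exists_coloring_aleph_one Ω hΩ
  | succ n ih =>
    obtain ⟨I, hI, hA⟩ := exists_small_segments (n + 1) Ω hΩ
    have hle : aleph (n + 1 : ℕ) ≤ #Ω := by
      rw [hΩ]
      exact aleph_le_aleph.2 (by exact_mod_cast Nat.le_succ _)
    obtain ⟨Ω₀, hΩ₀⟩ := le_mk_iff_exists_set.1 hle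
    obtain ⟨F, hF⟩ := ih Ω₀ hΩ₀
    have hemb : ∀ x, ∃ e : Ω → Ω₀, Set.InjOn e (I x) := by
      intro x
      obtain ⟨e⟩ : Nonempty (I x ↪ Ω₀) := by
        rw [← Cardinal.le_def, hΩ₀]
        exact hI x
      have : Nonempty Ω₀ := by
        rw [← mk_ne_zero_iff, hΩ₀]
        exact (aleph_pos _).ne'
      refine ⟨fun y => if h : y ∈ I x then e ⟨y, h⟩ else Classical.arbitrary _, ?_⟩
      intro y hy z hz hyz
      simp only [hy, hz, dif_pos] at hyz
      exact congrArg Subtype.val (e.injective hyz)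
    choose e he using hemb
    refine ⟨fun x => F fun i => e (x (Fin.last _)) (x i.castSucc), fun A hAcard k => ?_⟩
    have hB : ∀ i, ∃ B ⊆ A i, #B = aleph (n + 1 : ℕ) := by
      intro i
      refine le_mk_iff_exists_subset.1 ?_
      rw [hAcard i, ← hΩ]
      exact hle
    choose B hBA hBcard using hB
    have hunion : #(⋃ i, B i) ≤ aleph (n + 1 : ℕ) := by
      rw [← lift_uzero #(⋃ i, B i)]
      refine (mk_iUnion_le_lift B).trans ((mul_le_mul' ?_ (ciSup_le' fun i => ?_)).trans
        (mul_eq_self (aleph0_le_aleph _)).le)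
      · exact (lift_lt_aleph0.2 (lt_aleph0_of_finite _)).le.trans (aleph0_le_aleph _)
      · rw [lift_uzero, hBcard i]
    obtain ⟨x, hx, hsub⟩ := hA (A (Fin.last _)) (⋃ i, B i) (hAcard _) hunion
    obtain ⟨y, hy, hyk⟩ := hF (fun i => e x '' B i.castSucc) (fun i => by
      rw [mk_image_eq_of_injOn _ _ ((he x).mono ((Set.subset_iUnion B _).trans hsub))]
      exact hBcard _) k
    choose z hz hzy using hy
    refine ⟨Fin.snoc z x, ?_, ?_⟩
    · intro i
      refine Fin.lastCases ?_ (fun i => ?_) i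
      · simpa using hx
      · simpa using hBA _ (hz i)
    · simpa [hzy] using hyk

lemma isResolvable_aleph0_of_coloring {X : Type*} [TopologicalSpace X] [Nonempty X] (F : X → ℕ)
    (hF : ∀ U : Set X, IsOpen U → U.Nonempty → ∀ k, ∃ x ∈ U, F x = k) : IsResolvable ℵ₀ X := by
  have hdense : ∀ k, Dense (F ⁻¹' {k}) := fun k =>
    dense_iff_inter_open.2 fun U hU hUn => hF U hU hUn k
  have hinj : Function.Injective fun k => F ⁻¹' {k} := by
    intro k l h
    obtain ⟨x, hx⟩ := (hdense k).nonempty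
    have hx' : x ∈ F ⁻¹' {l} := (show F ⁻¹' {k} = F ⁻¹' {l} from h) ▸ hx
    exact hx.symm.trans hx'
  refine ⟨Set.range fun k => F ⁻¹' {k}, ?_, ?_, ?_⟩
  · have := mk_range_eq_of_injective hinj
    simpa using this
  · rintro _ ⟨k, rfl⟩ _ ⟨l, rfl⟩ hne
    exact Disjoint.preimage _ (Set.disjoint_singleton.2 fun h => hne (h ▸ rfl))
  · rintro _ ⟨k, rfl⟩
    exact hdense k

lemma Isodyne.preperfect_of_isOpen {X : Type*} [TopologicalSpace X] [Infinite X]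
    (hX : Isodyne X) {U : Set X} (hU : IsOpen U) : Preperfect U := by
  rw [preperfect_iff_nhds]
  intro x hx N hN
  obtain ⟨O, hON, hO, hxO⟩ := mem_nhds_iff.1 hN
  have hinf : (O ∩ U).Infinite := by
    rw [← Set.infinite_coe_iff, Cardinal.infinite_iff, hX _ (hO.inter hU) ⟨x, hxO, hx⟩]
    exact aleph0_le_mk X
  obtain ⟨y, hy, hyx⟩ := hinf.nontrivial.exists_ne x
  exact ⟨y, ⟨hON hy.1, hy.2⟩, hyx⟩

/-- The product of any `n + 2` Hausdorff isodyne spaces of cardinality `ℵ_n` is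
`ω`-resolvable. -/
theorem product_of_hausdorff_isodyne_aleph_n_spaces_is_omega_resolvable
    (n : ℕ) {X : Fin (n + 2) → Type*} [∀ i, TopologicalSpace (X i)]
    [∀ i, T2Space (X i)]
    (hiso : ∀ i, Isodyne (X i))
    (hcard : ∀ i, #(X i) = aleph n) :
    IsResolvable ℵ₀ (∀ i, X i) := by
  have : ∀ i, Infinite (X i) := fun i => by
    rw [Cardinal.infinite_iff, hcard i]
    exact aleph0_le_aleph _
  suffices h : ∃ F : (∀ i, X i) → ℕ, ∀ U : ∀ i, Set (X i), (∀ i, IsOpen (U i)) →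
      (∀ i, (U i).Nonempty) → ∀ k, ∃ x, (∀ i, x i ∈ U i) ∧ F x = k by
    obtain ⟨F, hF⟩ := h
    refine isResolvable_aleph0_of_coloring F ?_
    rintro U hU ⟨p, hp⟩ k
    obtain ⟨V, hV, hVU⟩ := isOpen_pi_iff'.1 hU p hp
    obtain ⟨x, hx, hxk⟩ := hF V (fun i => (hV i).1) (fun i => ⟨p i, (hV i).2⟩) k
    exact ⟨x, hVU fun i _ => hx i, hxk⟩
  cases n with
  | zero =>
    have : ∀ i, Countable (X i) := fun i => by
      rw [← mk_le_aleph0_iff, hcard i]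
      simp
    obtain ⟨c, hc⟩ := exists_coloring_of_countable (X 0) (X 1)
    refine ⟨fun x => c (x 0) (x 1), fun U hU hUn k => ?_⟩
    obtain ⟨y, hy, z, hz, hyz⟩ := hc (U 0) (U 1) ((hiso 0).preperfect_of_isOpen (hU 0)) (hUn 0)
      ((hiso 1).preperfect_of_isOpen (hU 1)) (hUn 1) k
    refine ⟨Fin.cons y (Fin.cons z finZeroElim), ?_, hyz⟩
    intro i
    fin_cases i
    exacts [hy, hz]
  | succ n =>
    obtain ⟨F, hF⟩ := exists_coloring_aleph_succ n (X 0) (hcard 0)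
    have he : ∀ i, Nonempty (X i ≃ X 0) := fun i => by
      rw [← Cardinal.eq, hcard i, hcard 0]
    let e := fun i => (he i).some
    refine ⟨fun x => F fun i => e i (x i), fun U hU hUn k => ?_⟩
    obtain ⟨x, hx, hxk⟩ := hF (fun i => e i '' U i) (fun i => by
      rw [mk_image_eq (e i).injective, hiso i _ (hU i) (hUn i), hcard i]) k
    choose y hy hyx using hx
    exact ⟨y, hy, by simpa [hyx] using hxk⟩
end

section
/- If an infinite isodyne topological space X is not ω-resolvable, then X contains a hereditarily irresolvable isodyne subspace of cardinality |X|. -/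
open Cardinal Topology

/-- A space is crowded iff it has no isolated points. -/
def Crowded (X : Type*) [TopologicalSpace X] : Prop :=
  ∀ x : X, ¬ IsOpen ({x} : Set X)

/-- A space is irresolvable iff it is crowded and not (2-)resolvable. -/
def Irresolvable (X : Type*) [TopologicalSpace X] : Prop :=
  Crowded X ∧ ¬ IsResolvable 2 X

/-- A space is hereditarily irresolvable iff it is irresolvable and contains no
resolvable subspace. -/
def HereditarilyIrresolvable (X : Type*) [TopologicalSpace X] : Prop :=
  Irresolvable X ∧ ∀ S : Set X, ¬ IsResolvable 2 S

/-- A nonempty set all of whose nonempty relatively open subsets have the cardinality of the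
ambient space. -/
def LocallyFull {X : Type*} [TopologicalSpace X] (A : Set X) : Prop :=
  A.Nonempty ∧ ∀ U : Set X, IsOpen U → (U ∩ A).Nonempty → #(U ∩ A : Set X) = #X

theorem LocallyFull.inter_isOpen {X : Type*} [TopologicalSpace X] {A W : Set X}
    (hA : LocallyFull A) (hW : IsOpen W) (hne : (W ∩ A).Nonempty) : LocallyFull (W ∩ A) := by
  refine ⟨hne, fun U hU h => ?_⟩
  rw [← Set.inter_assoc] at h ⊢
  exact hA.2 _ (hU.inter hW) h

theorem LocallyFull.mk_eq {X : Type*} [TopologicalSpace X] {A : Set X} (hA : LocallyFull A) :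
    #A = #X := by
  have := hA.2 Set.univ isOpen_univ (by simpa using hA.1)
  rwa [Set.univ_inter] at this

theorem LocallyFull.mk_eq_of_isOpen {X : Type*} [TopologicalSpace X] {A : Set X}
    (hA : LocallyFull A) {U : Set A} (hU : IsOpen U) (hne : U.Nonempty) : #U = #X := by
  obtain ⟨V, hV, rfl⟩ := isOpen_induced_iff.1 hU
  rw [← hA.2 V hV (by obtain ⟨x, hx⟩ := hne; exact ⟨x, hx, x.2⟩),
    ← mk_image_eq (s := ((↑) ⁻¹' V : Set A)) Subtype.val_injective,
    Subtype.image_preimage_coe, Set.inter_comm]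

theorem LocallyFull.isodyne {X : Type*} [TopologicalSpace X] {A : Set X} (hA : LocallyFull A) :
    Isodyne A :=
  fun _ hU hne => (hA.mk_eq_of_isOpen hU hne).trans hA.mk_eq.symm

theorem LocallyFull.crowded {X : Type*} [TopologicalSpace X] [Infinite X] {A : Set X}
    (hA : LocallyFull A) : Crowded A := by
  intro x hx
  have h := hA.mk_eq_of_isOpen hx (Set.singleton_nonempty x)
  have h' := aleph0_le_mk X
  rw [← h, mk_singleton] at h'
  exact absurd h' (not_le.2 one_lt_aleph0)

/-- `P` and `Q` are disjoint, and each is contained in the closure of the other. -/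
def MutuallyDense {X : Type*} [TopologicalSpace X] (P Q : Set X) : Prop :=
  Disjoint P Q ∧ P ⊆ closure Q ∧ Q ⊆ closure P

theorem IsResolvable.exists_mutuallyDense {X Y : Type*} [TopologicalSpace X] [TopologicalSpace Y]
    {f : Y → X} (hf : Continuous f) (hinj : Function.Injective f) (h : IsResolvable 2 Y) :
    ∃ P Q : Set X, P.Nonempty ∧ P ⊆ Set.range f ∧ Q ⊆ Set.range f ∧ MutuallyDense P Q := by
  obtain ⟨D, hD, hdisj, hdense⟩ := h
  obtain ⟨⟨P, hPD⟩, ⟨Q, hQD⟩, hne, -⟩ := mk_eq_two_iff.1 hD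
  have hPQ : P ≠ Q := fun h => hne (Subtype.ext h)
  have hP : Dense P := hdense P hPD
  have hQ : Dense Q := hdense Q hQD
  have hd : Disjoint P Q := hdisj hPD hQD hPQ
  have hY : Nonempty Y := by
    by_contra hY
    rw [not_nonempty_iff] at hY
    exact hPQ (Subsingleton.elim _ _)
  refine ⟨f '' P, f '' Q, hP.nonempty.image f, Set.image_subset_range _ _,
    Set.image_subset_range _ _, (Set.disjoint_image_iff hinj).2 hd, ?_, ?_⟩
  · exact (Set.image_mono fun x _ => hQ x).trans (image_closure_subset_closure_image hf)
  · exact (Set.image_mono fun x _ => hP x).trans (image_closure_subset_closure_image hf)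

theorem exists_maximal_mutuallyDense {X : Type*} [TopologicalSpace X] (A : Set X) :
    ∃ p : Set X × Set X,
      Maximal (fun p => p.1 ⊆ A ∧ p.2 ⊆ A ∧ MutuallyDense p.1 p.2) p := by
  have h₀ : (∅, ∅) ∈ {p : Set X × Set X | p.1 ⊆ A ∧ p.2 ⊆ A ∧ MutuallyDense p.1 p.2} := by
    simp [MutuallyDense]
  suffices h : _ from (zorn_le_nonempty₀ _ h _ h₀).imp fun _ hm => hm.2
  intro c hc hchain y hy
  refine ⟨(⋃ p ∈ c, p.1, ⋃ p ∈ c, p.2), ⟨?_, ?_, ?_, ?_, ?_⟩, ?_⟩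
  · exact Set.iUnion₂_subset fun p hp => (hc hp).1
  · exact Set.iUnion₂_subset fun p hp => (hc hp).2.1
  · simp only [Set.disjoint_iUnion_left, Set.disjoint_iUnion_right]
    intro q hq p hp
    rcases hchain.total hp hq with h | h
    · exact (hc hq).2.2.1.mono_left h.1
    · exact (hc hp).2.2.1.mono_right h.2
  · exact Set.iUnion₂_subset fun p hp => (hc hp).2.2.2.1.trans
      (closure_mono (Set.subset_biUnion_of_mem (u := fun p : Set X × Set X => p.2) hp))
  · exact Set.iUnion₂_subset fun p hp => (hc hp).2.2.2.2.trans
      (closure_mono (Set.subset_biUnion_of_mem (u := fun p : Set X × Set X => p.1) hp))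
  · exact fun p hp => ⟨Set.subset_biUnion_of_mem (u := fun p : Set X × Set X => p.1) hp,
      Set.subset_biUnion_of_mem (u := fun p : Set X × Set X => p.2) hp⟩

theorem MutuallyDense.union {X : Type*} [TopologicalSpace X] {P Q P' Q' : Set X}
    (h : MutuallyDense P Q) (h' : MutuallyDense P' Q') (h₁ : Disjoint P Q') (h₂ : Disjoint P' Q) :
    MutuallyDense (P ∪ P') (Q ∪ Q') := by
  refine ⟨?_, ?_, ?_⟩
  · simp only [Set.disjoint_union_left, Set.disjoint_union_right]
    exact ⟨⟨h.1, h₂⟩, h₁, h'.1⟩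
  · rw [closure_union]
    exact Set.union_subset_union h.2.1 h'.2.1
  · rw [closure_union]
    exact Set.union_subset_union h.2.2 h'.2.2

/-- A locally full set without hereditarily irresolvable locally full subsets has two disjoint
dense subsets. -/
theorem LocallyFull.exists_mutuallyDense {X : Type*} [TopologicalSpace X] [Infinite X] {A : Set X}
    (hA : LocallyFull A)
    (hX : ∀ S : Set X, LocallyFull S → ¬ HereditarilyIrresolvable S) :
    ∃ P Q : Set X, P ⊆ A ∧ Q ⊆ A ∧ Disjoint P Q ∧ A ⊆ closure P ∧ A ⊆ closure Q := by
  obtain ⟨⟨P, Q⟩, ⟨hPA, hQA, hPQ⟩, hmax⟩ := exists_maximal_mutuallyDense A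
  dsimp only at hPA hQA hPQ
  have hcl : closure Q = closure P :=
    (closure_minimal hPQ.2.2 isClosed_closure).antisymm (closure_minimal hPQ.2.1 isClosed_closure)
  by_cases hne : ((closure P)ᶜ ∩ A).Nonempty
  · have hS := hA.inter_isOpen isClosed_closure.isOpen_compl hne
    refine absurd ?_ (hX _ hS)
    have key : ∀ P' Q' : Set X, P'.Nonempty → P' ⊆ (closure P)ᶜ ∩ A → Q' ⊆ (closure P)ᶜ ∩ A →
        ¬ MutuallyDense P' Q' := by
      intro P' Q' hP'ne hP' hQ' h
      have h₁ : Disjoint P Q' := Set.disjoint_left.2 fun x hx hx' =>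
        (hQ' hx').1 (subset_closure hx)
      have h₂ : Disjoint P' Q := Set.disjoint_left.2 fun x hx hx' =>
        (hP' hx).1 (hcl ▸ subset_closure hx')
      have hle := hmax (y := (P ∪ P', Q ∪ Q'))
        ⟨Set.union_subset hPA fun x hx => (hP' hx).2, Set.union_subset hQA fun x hx => (hQ' hx).2,
          hPQ.union h h₁ h₂⟩ ⟨Set.subset_union_left, Set.subset_union_left⟩
      obtain ⟨x, hx⟩ := hP'ne
      exact (hP' hx).1 (subset_closure (hle.1 (Or.inr hx)))
    refine ⟨⟨hS.crowded, fun h => ?_⟩, fun T h => ?_⟩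
    · obtain ⟨P', Q', h₀, h₁, h₂, h₃⟩ :=
        h.exists_mutuallyDense continuous_subtype_val Subtype.val_injective
      rw [Subtype.range_coe] at h₁ h₂
      exact key P' Q' h₀ h₁ h₂ h₃
    · obtain ⟨P', Q', h₀, h₁, h₂, h₃⟩ :=
        h.exists_mutuallyDense (continuous_subtype_val.comp continuous_subtype_val)
          (Subtype.val_injective.comp Subtype.val_injective)
      have hr : Set.range ((Subtype.val : ↥((closure P)ᶜ ∩ A) → X) ∘ (Subtype.val : T → _)) ⊆
          (closure P)ᶜ ∩ A := by
        rintro _ ⟨x, rfl⟩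
        exact x.1.2
      exact key P' Q' h₀ (h₁.trans hr) (h₂.trans hr) h₃
  · have hsub : A ⊆ closure P := fun x hx => by
      by_contra hx'
      exact hne ⟨x, hx', hx⟩
    exact ⟨P, Q, hPA, hQA, hPQ.1, hsub, hcl ▸ hsub⟩

/-- If a locally full set has two disjoint dense subsets, then one of them can be chosen locally
full. -/
theorem LocallyFull.exists_locallyFull_dense {X : Type*} [TopologicalSpace X] [Infinite X]
    {A P Q : Set X} (hA : LocallyFull A) (hPA : P ⊆ A) (hQA : Q ⊆ A) (hPQ : Disjoint P Q)
    (hP : A ⊆ closure P) (hQ : A ⊆ closure Q) :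
    ∃ B ⊆ A, LocallyFull B ∧ A ⊆ closure B ∧ A ⊆ closure (A \ B) := by
  let W : Set X := ⋃₀ {U | IsOpen U ∧ #(U ∩ P : Set X) < #X}
  have hW : IsOpen W := isOpen_sUnion fun U hU => hU.1
  let B : Set X := ((A \ P) ∩ W) ∪ (P \ closure (W ∩ A))
  have hBA : B ⊆ A := by
    rintro x (hx | hx)
    exacts [hx.1.1, hPA hx.1]
  have hfull : ∀ V : Set X, IsOpen V → (V ∩ A).Nonempty → #(V ∩ B : Set X) = #X := by
    intro V hV hVA
    refine le_antisymm (mk_set_le _) ?_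
    by_cases hWV : (V ∩ (W ∩ A)).Nonempty
    · obtain ⟨x, hxV, ⟨U, hU, hxU⟩, hxA⟩ := hWV
      have hUV := hA.2 (V ∩ U) (hV.inter hU.1) ⟨x, ⟨hxV, hxU⟩, hxA⟩
      have hsub : V ∩ U ∩ A ⊆ (U ∩ P) ∪ (V ∩ B) := by
        rintro y ⟨⟨hyV, hyU⟩, hyA⟩
        by_cases hyP : y ∈ P
        · exact Or.inl ⟨hyU, hyP⟩
        · exact Or.inr ⟨hyV, Or.inl ⟨⟨hyA, hyP⟩, U, hU, hyU⟩⟩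
      have hle := (mk_le_mk_of_subset hsub).trans (mk_union_le _ _)
      rw [hUV] at hle
      by_contra hlt
      exact absurd hle (not_le.2 (add_lt_of_lt (aleph0_le_mk X) hU.2 (not_le.1 hlt)))
    · have hdisj : V ∩ closure (W ∩ A) = ∅ :=
        (Set.disjoint_iff_inter_eq_empty.1 ((Set.disjoint_iff_inter_eq_empty.2
          (Set.not_nonempty_iff_eq_empty.1 hWV)).closure_right hV))
      have hge : #X ≤ #(V ∩ P : Set X) := by
        by_contra hlt
        obtain ⟨x, hxV, hxA⟩ := hVA
        exact hWV ⟨x, hxV, ⟨V, ⟨hV, not_le.1 hlt⟩, hxV⟩, hxA⟩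
      refine hge.trans (mk_le_mk_of_subset ?_)
      rintro x ⟨hxV, hxP⟩
      exact ⟨hxV, Or.inr ⟨hxP, fun h => (hdisj.le ⟨hxV, h⟩).elim⟩⟩
  have hmeet : ∀ V : Set X, IsOpen V → (V ∩ A).Nonempty → (V ∩ B).Nonempty := by
    intro V hV hVA
    rw [← Set.nonempty_coe_sort, ← mk_ne_zero_iff, hfull V hV hVA]
    exact mk_ne_zero X
  refine ⟨B, hBA, ⟨?_, fun U hU hUB => hfull U hU ?_⟩, fun x hx => ?_, fun x hx => ?_⟩
  · simpa using hmeet Set.univ isOpen_univ (by simpa using hA.1)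
  · exact hUB.mono (Set.inter_subset_inter_right _ hBA)
  · exact mem_closure_iff.2 fun V hV hxV => hmeet V hV ⟨x, hxV, hx⟩
  · refine mem_closure_iff.2 fun V hV hxV => ?_
    by_cases hWV : (V ∩ (W ∩ A)).Nonempty
    · obtain ⟨y, hyV, hyW, hyA⟩ := hWV
      obtain ⟨z, ⟨hzV, hzW⟩, hzP⟩ := mem_closure_iff.1 (hP hyA) _ (hV.inter hW) ⟨hyV, hyW⟩
      refine ⟨z, hzV, hPA hzP, ?_⟩
      rintro (hz | hz)
      exacts [hz.1.2 hzP, hz.2 (subset_closure ⟨hzW, hPA hzP⟩)]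
    · obtain ⟨z, hzV, hzQ⟩ := mem_closure_iff.1 (hQ hx) V hV hxV
      refine ⟨z, hzV, hQA hzQ, ?_⟩
      rintro (hz | hz)
      exacts [hWV ⟨z, hzV, hz.2, hQA hzQ⟩, Set.disjoint_left.1 hPQ hz.1 hzQ]

/-- A decreasing sequence of dense sets with dense successive differences witnesses
`ℵ₀`-resolvability. -/
theorem isResolvable_aleph0_of_antitone {X : Type*} [TopologicalSpace X] [Nonempty X]
    {B : ℕ → Set X} (hB : Antitone B) (hd : ∀ n, Dense (B n \ B (n + 1))) :
    IsResolvable ℵ₀ X := by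
  have hdisj : Pairwise (Function.onFun Disjoint fun n => B n \ B (n + 1)) := by
    refine (pairwise_disjoint_on _).2 fun m n hmn => Set.disjoint_left.2 fun x hx hx' => ?_
    exact hx.2 (hB hmn hx'.1)
  have hinj : Function.Injective fun n => B n \ B (n + 1) := by
    intro m n hmn
    by_contra hne
    have h := hdisj hne
    dsimp only [Function.onFun] at h hmn
    rw [hmn, disjoint_self] at h
    exact (hd n).nonempty.ne_empty h
  refine ⟨Set.range fun n => B n \ B (n + 1), ?_, ?_, ?_⟩
  · simpa using mk_range_eq_of_injective hinj
  · rintro _ ⟨m, rfl⟩ _ ⟨n, rfl⟩ hne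
    exact hdisj fun h => hne (by rw [h])
  · rintro _ ⟨n, rfl⟩
    exact hd n

/-- If an infinite isodyne space `X` is not `ω`-resolvable, then `X` contains a hereditarily
irresolvable isodyne subspace of cardinality `|X|`. -/
theorem exists_hereditarily_irresolvable_isodyne_subspace
    {X : Type*} [TopologicalSpace X] [Infinite X]
    (hiso : Isodyne X) (h : ¬ IsResolvable ℵ₀ X) :
    ∃ S : Set X, HereditarilyIrresolvable S ∧ Isodyne S ∧ #S = #X := by
  by_contra hcon
  have hX : ∀ S : Set X, LocallyFull S → ¬ HereditarilyIrresolvable S :=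
    fun S hS hHI => hcon ⟨S, hHI, hS.isodyne, hS.mk_eq⟩
  have hstep : ∀ A : {A : Set X // LocallyFull A}, ∃ B : {B : Set X // LocallyFull B},
      B.1 ⊆ A.1 ∧ A.1 ⊆ closure B.1 ∧ A.1 ⊆ closure (A.1 \ B.1) := by
    rintro ⟨A, hA⟩
    obtain ⟨P, Q, hPA, hQA, hPQ, hP, hQ⟩ := hA.exists_mutuallyDense hX
    obtain ⟨B, hBA, hB, h₁, h₂⟩ := hA.exists_locallyFull_dense hPA hQA hPQ hP hQ
    exact ⟨⟨B, hB⟩, hBA, h₁, h₂⟩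
  choose next hsub hdense hdiff using hstep
  have huniv : LocallyFull (Set.univ : Set X) := by
    refine ⟨Set.univ_nonempty, fun U hU hne => ?_⟩
    rw [Set.inter_univ] at hne ⊢
    exact hiso U hU hne
  let B : ℕ → {A : Set X // LocallyFull A} := fun n => next^[n] ⟨Set.univ, huniv⟩
  have hB : ∀ n, B (n + 1) = next (B n) := fun n => Function.iterate_succ_apply' _ _ _
  have hBd : ∀ n, Dense (B n).1 := by
    intro n
    induction n with
    | zero => exact dense_univ
    | succ n ih => exact dense_closure.1 (ih.mono (hB n ▸ hdense (B n)))
  refine h (isResolvable_aleph0_of_antitone (B := fun n => (B n).1)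
    (antitone_nat_of_succ_le fun n => hB n ▸ hsub (B n)) fun n => ?_)
  exact dense_closure.1 ((hBd n).mono (hB n ▸ hdiff (B n)))
end

section
/- If X is an isodyne topological space whose cardinality |X| is a regular cardinal, and the set tr(X) is dense in X, then X is maximally resolvable, i.e. X is Δ(X)-resolvable. -/
open Cardinal Topology Filter

/-- `tr X` is the set of all points `x ∈ X` such that for every set `A ⊆ X` of cardinality
less than `|X|` there is a set `B ⊆ X \ A` of cardinality less than `|X|` such that `x` is a
limit point of `B`. -/
def tr (X : Type*) [TopologicalSpace X] : Set X :=
  {x | ∀ A : Set X, #A < #X → ∃ B : Set X, B ⊆ Aᶜ ∧ #B < #X ∧ AccPt x (𝓟 B)}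

/-- The dispersion character `Δ(X)`: the smallest cardinality of a nonempty open subset. -/
noncomputable def dispersion (X : Type*) [TopologicalSpace X] : Cardinal :=
  sInf {c | ∃ U : Set X, IsOpen U ∧ U.Nonempty ∧ #U = c}

universe u

/-- Transfinite recursion of regular length: if each `P i` is satisfied by a small set avoiding any
prescribed small set, then the `P i` are satisfied by pairwise disjoint sets. -/
theorem exists_pairwise_disjoint_of_isRegular {ι α : Type u} {c : Cardinal.{u}}
    (hc : c.IsRegular) (hι : #ι ≤ c) {P : ι → Set α → Prop}
    (h : ∀ i, ∀ A : Set α, #A < c → ∃ B : Set α, B ⊆ Aᶜ ∧ #B < c ∧ P i B) :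
    ∃ f : ι → Set α, Pairwise (Function.onFun Disjoint f) ∧ ∀ i, P i (f i) := by
  obtain ⟨_, _, hord⟩ := exists_ord_eq_type_lt ι
  have hsmall (i : ι) (F : ∀ j, j < i → {B : Set α // #B < c}) :
      #(⋃ j : Set.Iio i, (F j j.2 : Set α)) < c :=
    (card_iUnion_lt_iff_forall_of_isRegular hc ((mk_Iio_lt i hord).trans_le hι)).2
      fun j => (F j j.2).2
  choose g hg_sub hg_card hgP using h
  let f : ι → {B : Set α // #B < c} :=
    wellFounded_lt.fix fun i F => ⟨g i _ (hsmall i F), hg_card i _ (hsmall i F)⟩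
  have hf (i : ι) : (f i : Set α) = g i _ (hsmall i fun j _ => f j) :=
    congrArg Subtype.val (show f i = ⟨g i _ (hsmall i fun j _ => f j), hg_card i _ _⟩ from
      wellFounded_lt.fix_eq _ i)
  have hlt {i j : ι} (hij : i < j) : Disjoint (f i : Set α) (f j) := by
    rw [hf j]
    refine (Set.disjoint_left.2 fun x hx hxi => hg_sub j _ _ hx ?_).symm
    exact Set.mem_iUnion.2 ⟨⟨i, hij⟩, hxi⟩
  refine ⟨fun i => f i, fun i j hij => ?_, fun i => ?_⟩
  · exact hij.lt_or_gt.elim hlt fun hji => (hlt hji).symm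
  · beta_reduce
    rw [hf i]
    exact hgP i _ _

theorem Isodyne.dispersion_eq {X : Type*} [TopologicalSpace X] [Nonempty X] (h : Isodyne X) :
    dispersion X = #X := by
  have : {c | ∃ U : Set X, IsOpen U ∧ U.Nonempty ∧ #U = c} = {#X} := by
    ext c
    constructor
    · rintro ⟨U, hU, hne, rfl⟩
      exact h U hU hne
    · rintro rfl
      exact ⟨Set.univ, isOpen_univ, Set.univ_nonempty, mk_univ⟩
  rw [dispersion, this, csInf_singleton]

/-- An indexed family of pairwise disjoint dense sets in a nonempty space witnesses resolvability. -/
theorem IsResolvable.of_pairwise_disjoint {X ι : Type u} [TopologicalSpace X] [Nonempty X]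
    {D : ι → Set X} (hdisj : Pairwise (Function.onFun Disjoint D)) (hD : ∀ i, Dense (D i)) :
    IsResolvable #ι X := by
  have hinj : Function.Injective D := fun i j hij => by
    by_contra hne
    have hself : Disjoint (D i) (D j) := hdisj hne
    rw [← hij, disjoint_self] at hself
    exact (hD i).nonempty.ne_empty hself
  refine ⟨Set.range D, mk_range_eq D hinj, ?_, Set.forall_mem_range.2 hD⟩
  rintro _ ⟨i, rfl⟩ _ ⟨j, rfl⟩ hij
  exact hdisj fun h => hij (congrArg D h)

/-- If `X` is an isodyne space of regular cardinality and `tr X` is dense in `X`, then `X` is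
maximally resolvable. -/
theorem maximally_resolvable_of_tr_dense
    {X : Type*} [TopologicalSpace X]
    (hiso : Isodyne X) (hreg : (#X).IsRegular) (hdense : Dense (tr X)) :
    IsResolvable (dispersion X) X := by
  have hne : Nonempty X := mk_ne_zero_iff.1 hreg.ne_zero
  rw [hiso.dispersion_eq]
  have hcard : #(tr X × X) ≤ #X := by
    rw [← mul_def]
    exact (mul_le_mul_left (mk_set_le (tr X)) #X).trans (mul_eq_self hreg.aleph0_le).le
  obtain ⟨f, hdisj, hf⟩ := exists_pairwise_disjoint_of_isRegular hreg hcard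
    (P := fun p B => AccPt (p.1 : X) (𝓟 B)) fun p => p.1.2
  refine IsResolvable.of_pairwise_disjoint (D := fun y => ⋃ x, f (x, y)) (fun y z hyz => ?_)
    fun y => ?_
  · refine Set.disjoint_iUnion_left.2 fun x => Set.disjoint_iUnion_right.2 fun x' => hdisj ?_
    exact fun h => hyz (congrArg Prod.snd h)
  · refine (hdense.mono fun x hx => ?_).of_closure
    refine closure_mono (Set.subset_iUnion _ ⟨x, hx⟩) ?_
    exact mem_closure_iff_clusterPt.2 (hf (⟨x, hx⟩, y)).clusterPt
end

section
/- Every regular topological space is ω₁-disentangled: for every ω₁-rare family ℋ of subsets of a regular space X there exist pairwise disjoint open sets O(A), for A ∈ ℋ, with A ⊆ O(A) for each A ∈ ℋ. -/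
open Cardinal Topology

/-- A set `A` is `κ`-remote iff `A ∩ cl S = ∅` whenever `S ⊆ X \ A` and `|S| < κ`. -/
def Remote (κ : Cardinal) {X : Type*} [TopologicalSpace X] (A : Set X) : Prop :=
  ∀ S : Set X, S ⊆ Aᶜ → #S < κ → A ∩ closure S = ∅

/-- A disjoint family `ℋ` is `κ`-rare iff all its elements are `κ`-remote and `|⋃ℋ| < κ`. -/
def Rare (κ : Cardinal) {X : Type*} [TopologicalSpace X] (ℋ : Set (Set X)) : Prop :=
  ℋ.PairwiseDisjoint id ∧ (∀ A ∈ ℋ, Remote κ A) ∧ #(⋃₀ ℋ) < κ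

/-- A space is `κ`-disentangled iff every `κ`-rare family can be separated by pairwise
disjoint open sets. -/
def Disentangled (κ : Cardinal) (X : Type*) [TopologicalSpace X] : Prop :=
  ∀ ℋ : Set (Set X), Rare κ ℋ →
    ∃ O : Set X → Set X, (∀ A ∈ ℋ, IsOpen (O A) ∧ A ⊆ O A) ∧ ℋ.PairwiseDisjoint O

/-- In a regular space, a point of an `ω₁`-remote set `A` has an open neighbourhood whose closure
misses any given countable set disjoint from `A`. -/
theorem Remote.exists_isOpen_disjoint_closure {X : Type*} [TopologicalSpace X] [RegularSpace X]
    {A S : Set X} (hA : Remote (aleph 1) A) (hSA : S ⊆ Aᶜ) (hS : S.Countable) {x : X}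
    (hx : x ∈ A) : ∃ U, IsOpen U ∧ x ∈ U ∧ Disjoint (closure U) S := by
  have hxS : x ∉ closure S := fun h ↦
    (hA S hSA (lt_aleph_one_iff.2 (le_aleph0_iff_set_countable.2 hS))).subset ⟨hx, h⟩
  obtain ⟨K, ⟨hK, hKc⟩, hKS⟩ :=
    (closed_nhds_basis x).mem_iff.1 (isClosed_closure.isOpen_compl.mem_nhds hxS)
  refine ⟨interior K, isOpen_interior, mem_interior_iff_mem_nhds.2 hK, ?_⟩
  exact Set.disjoint_left.2 fun y hy hyS ↦
    hKS (closure_minimal interior_subset hKc hy) (subset_closure hyS)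

/-- Every regular space is `ω₁`-disentangled. -/
theorem regular_space_is_aleph_one_disentangled
    {X : Type*} [TopologicalSpace X] [RegularSpace X] :
    Disentangled (aleph 1) X := by
  rintro ℋ ⟨hdisj, hremote, hcard⟩
  have hY : (⋃₀ ℋ).Countable := le_aleph0_iff_set_countable.1 (lt_aleph_one_iff.1 hcard)
  obtain ⟨f, hf⟩ := Set.countable_iff_exists_injOn.1 hY
  have key : ∀ x, ∃ U : Set X, IsOpen U ∧ (x ∈ ⋃₀ ℋ → x ∈ U) ∧
      ∀ A ∈ ℋ, x ∈ A → Disjoint (closure U) (⋃₀ ℋ \ A) := by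
    intro x
    by_cases hx : x ∈ ⋃₀ ℋ
    · obtain ⟨A, hA, hxA⟩ := hx
      obtain ⟨U, hU, hxU, hd⟩ := (hremote A hA).exists_isOpen_disjoint_closure
        (fun _ h ↦ h.2) (hY.mono Set.sdiff_subset) hxA
      refine ⟨U, hU, fun _ ↦ hxU, fun B hB hxB ↦ ?_⟩
      rwa [hdisj.elim_set hB hA x hxB hxA]
    · exact ⟨∅, isOpen_empty, fun h ↦ (hx h).elim, fun A hA hxA ↦ (hx ⟨A, hA, hxA⟩).elim⟩
  choose U hU hxU hd using key
  refine ⟨fun A ↦ ⋃ x ∈ A, U x \ ⋃ y ∈ {y | y ∈ ⋃₀ ℋ \ A ∧ f y ≤ f x}, closure (U y),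
    fun A hA ↦ ⟨?_, ?_⟩, ?_⟩
  · refine isOpen_biUnion fun x _ ↦ (hU x).sdiff (Set.Finite.isClosed_biUnion ?_
      fun _ _ ↦ isClosed_closure)
    exact Set.Finite.of_injOn (fun y hy ↦ hy.2) (hf.mono fun y hy ↦ hy.1.1)
      (Set.finite_Iic (f x))
  · intro x hx
    refine Set.mem_biUnion hx ⟨hxU x ⟨A, hA, hx⟩, ?_⟩
    simp only [Set.mem_iUnion, not_exists]
    rintro y ⟨⟨⟨B, hB, hyB⟩, hyA⟩, -⟩ hxy
    refine Set.disjoint_left.1 (hd y B hB hyB) hxy ⟨⟨A, hA, hx⟩, fun hxB ↦ hyA ?_⟩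
    rwa [hdisj.elim_set hA hB x hx hxB]
  · intro A hA B hB hAB
    refine Set.disjoint_left.2 fun z hzA hzB ↦ ?_
    obtain ⟨x, hx, hzx, hzx'⟩ := Set.mem_iUnion₂.1 hzA
    obtain ⟨y, hy, hzy, hzy'⟩ := Set.mem_iUnion₂.1 hzB
    rcases le_total (f y) (f x) with h | h
    · exact hzx' (Set.mem_biUnion
        ⟨⟨⟨B, hB, hy⟩, fun hyA ↦ hAB (hdisj.elim_set hA hB y hyA hy)⟩, h⟩ (subset_closure hzy))
    · exact hzy' (Set.mem_biUnion
        ⟨⟨⟨A, hA, hx⟩, fun hxB ↦ hAB (hdisj.elim_set hA hB x hx hxB)⟩, h⟩ (subset_closure hzx))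
end

section
/- Every nonempty topological space contains a nonempty open subspace which is isodyne (as a subspace). -/
open Cardinal Topology

/-- Every nonempty space contains a nonempty open isodyne subspace. -/
theorem exists_nonempty_open_isodyne_subspace
    {X : Type*} [TopologicalSpace X] [Nonempty X] :
    ∃ U : Set X, IsOpen U ∧ U.Nonempty ∧ Isodyne U := by
  obtain ⟨U, ⟨hU, hne⟩, hmin⟩ := exists_minimalFor_of_wellFoundedLT
    (fun U : Set X => IsOpen U ∧ U.Nonempty) (fun U => #U) ⟨Set.univ, isOpen_univ, Set.univ_nonempty⟩
  refine ⟨U, hU, hne, fun V hV hVne => le_antisymm (mk_set_le V) ?_⟩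
  calc
    #U ≤ #(Subtype.val '' V : Set X) :=
      (le_total _ _).elim id
        (hmin ⟨hU.isOpenMap_subtype_val V hV, hVne.image _⟩)
    _ = #V := mk_image_eq Subtype.val_injective
end
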